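/- Let q be a power of a prime p, let n ≥ 3, let k be the field with q elements, and let G = Sp_{2n}(q) be the symplectic group of 2n×2n matrices over k preserving the standard symplectic form, acting on the natural module M = k^{2n} by matrix multiplication. Then M is a non-algebraic kG-module. -/

import Mathlib

open CategoryTheory CategoryTheory.MonoidalCategory

namespace AlgebraicModule

variable {k G : Type} [Field k] [Monoid G]

/-- `N` is a direct summand of `M`, i.e. a retract of `M`. -/
def IsSummand (N M : FDRep k G) : Prop :=
  ∃ (i : N ⟶ M) (r : M ⟶ N), i ≫ r = 𝟙 N

/-- `M` is an indecomposable module: it is nonzero and is not the direct sum of two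
nonzero submodules (equivalently, its only idempotent endomorphisms are `0` and `1`). -/
def Indecomposable (M : FDRep k G) : Prop :=
  ¬ Limits.IsZero M ∧ ∀ e : M ⟶ M, e ≫ e = e → e = 0 ∨ e = 𝟙 M

/-- `tensorPow M n` is the tensor power `M^{⊗ (n + 1)}`, with diagonal `G`-action. -/
noncomputable def tensorPow (M : FDRep k G) : ℕ → FDRep k G
  | 0 => M
  | n + 1 => tensorPow M n ⊗ M

/-- `M` is algebraic: only finitely many isomorphism classes of indecomposable modules
occur as direct summands of the tensor powers `M^{⊗ n}` for `n ≥ 1`. -/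
noncomputable def IsAlgebraic (M : FDRep k G) : Prop :=
  ∃ L : List (FDRep k G), ∀ N : FDRep k G, Indecomposable N →
    (∃ n : ℕ, IsSummand N (tensorPow M n)) → ∃ N' ∈ L, Nonempty (N ≅ N')

end AlgebraicModule

open AlgebraicModule

/-- The natural representation of the symplectic group `Sp_{2n}(k)` on `k^{2n}`,
by matrix multiplication. -/
noncomputable def SpnatRep (k : Type) [Field k] (n : ℕ) :
    Representation k (Matrix.symplecticGroup (Fin n) k) ((Fin n ⊕ Fin n) → k) where
  toFun g := Matrix.mulVecLin (g : Matrix (Fin n ⊕ Fin n) (Fin n ⊕ Fin n) k)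
  map_one' := by ext v i; simp
  map_mul' g h := by ext v i; simp [Matrix.mulVecLin_mul]



namespace SpNA
open scoped TensorProduct

/-- modules with two commuting operators of order dividing `p` -/
structure RMod (k : Type) [Field k] (p : ℕ) where
  V : Type
  [acg : AddCommGroup V]
  [mod : Module k V]
  g : Module.End k V
  h : Module.End k V
  gp : g ^ p = 1
  hp : h ^ p = 1
  comm : g * h = h * g

attribute [instance] RMod.acg RMod.mod

section basic
variable {k : Type} [Field k] {p : ℕ}

noncomputable def CS {V W : Type} [AddCommGroup V] [Module k V] [AddCommGroup W] [Module k W]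
    (p : ℕ) (A : Module.End k W) (B : Module.End k V) (θ : V →ₗ[k] W) : V →ₗ[k] W :=
  ∑ i ∈ Finset.range p, (A ^ i) ∘ₗ θ ∘ₗ (B ^ i)

section CS
variable {V W U : Type} [AddCommGroup V] [Module k V] [AddCommGroup W] [Module k W]
  [AddCommGroup U] [Module k U]

lemma CS_apply (A : Module.End k W) (B : Module.End k V) (θ : V →ₗ[k] W) (v : V) :
    CS p A B θ v = ∑ i ∈ Finset.range p, (A ^ i) (θ ((B ^ i) v)) := by
  simp [CS]

lemma CS_conj (A : Module.End k W) (B : Module.End k V) (hA : A ^ p = 1) (hB : B ^ p = 1)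
    (θ : V →ₗ[k] W) (v : V) : A (CS p A B θ (B v)) = CS p A B θ v := by
  simp only [CS_apply, map_sum]
  have : ∀ i, A ((A ^ i) (θ ((B ^ i) (B v)))) = (A ^ (i+1)) (θ ((B ^ (i+1)) v)) := by
    intro i
    rw [pow_succ', pow_succ B]; rfl
  simp only [this]
  have h1 := Finset.sum_range_succ' (fun i => (A ^ i) (θ ((B ^ i) v))) p
  have h2 := Finset.sum_range_succ (fun i => (A ^ i) (θ ((B ^ i) v))) p
  rw [h1] at h2
  simp only [hA, hB, pow_zero] at h2
  exact add_right_cancel h2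

lemma CS_comm (hp : 0 < p) (A : Module.End k W) (B : Module.End k V) (hA : A ^ p = 1)
    (hB : B ^ p = 1) (θ : V →ₗ[k] W) :
    (CS p A (B ^ (p-1)) θ) ∘ₗ B = A ∘ₗ CS p A (B ^ (p-1)) θ := by
  have hB' : (B ^ (p-1)) ^ p = 1 := by rw [← pow_mul, mul_comm, pow_mul, hB, one_pow]
  ext v
  simp only [LinearMap.comp_apply]
  rw [← CS_conj A (B ^ (p-1)) hA hB' θ (B v)]
  congr 2
  have : (B ^ (p-1)) (B v) = (B ^ (p - 1) * B) v := rfl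
  rw [this, ← pow_succ, Nat.sub_add_cancel hp, hB]; rfl

lemma pow_intertwine {A : Module.End k W} {B : Module.End k V} {f : V →ₗ[k] W}
    (hf : f ∘ₗ B = A ∘ₗ f) (i : ℕ) : f ∘ₗ (B ^ i) = (A ^ i) ∘ₗ f := by
  induction i with
  | zero => rfl
  | succ i ih =>
    ext v
    have h1 := LinearMap.congr_fun ih (B v)
    have h2 := LinearMap.congr_fun hf v
    simp only [LinearMap.comp_apply] at h1 h2 ⊢
    rw [pow_succ, pow_succ]
    simp only [Module.End.mul_apply]
    rw [h1, h2]

lemma CS_left {A : Module.End k W} {A' : Module.End k U} (B : Module.End k V)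
    {f : W →ₗ[k] U} (hf : f ∘ₗ A = A' ∘ₗ f) (θ : V →ₗ[k] W) :
    f ∘ₗ CS p A B θ = CS p A' B (f ∘ₗ θ) := by
  ext v
  simp only [LinearMap.comp_apply, CS_apply, map_sum]
  refine Finset.sum_congr rfl fun i _ => ?_
  exact LinearMap.congr_fun (pow_intertwine hf i) _

lemma CS_right (A : Module.End k W) {B : Module.End k V} {B' : Module.End k U}
    {f : U →ₗ[k] V} (hf : f ∘ₗ B' = B ∘ₗ f) (θ : V →ₗ[k] W) :
    CS p A B θ ∘ₗ f = CS p A B' (θ ∘ₗ f) := by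
  ext v
  simp only [LinearMap.comp_apply, CS_apply]
  refine Finset.sum_congr rfl fun i _ => ?_
  have := LinearMap.congr_fun (pow_intertwine hf i) v
  simp only [LinearMap.comp_apply] at this
  rw [this]

lemma CS_tensor_right (A : Module.End k W) (B : Module.End k V) (C D : Module.End k U)
    (hCD : ∀ i, C ^ i * D ^ i = 1) (θ : V →ₗ[k] W) :
    CS p (TensorProduct.map A C : Module.End k (W ⊗[k] U)) (TensorProduct.map B D : Module.End k (V ⊗[k] U))
      (TensorProduct.map θ LinearMap.id) = TensorProduct.map (CS p A B θ) LinearMap.id := by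
  ext v u
  simp only [TensorProduct.AlgebraTensorModule.curry_apply, LinearMap.restrictScalars_self,
    TensorProduct.curry_apply, CS_apply, TensorProduct.map_tmul, TensorProduct.map_pow,
    LinearMap.id_apply, TensorProduct.sum_tmul]
  refine Finset.sum_congr rfl fun i _ => ?_
  have := LinearMap.congr_fun (hCD i) u
  simp only [Module.End.mul_apply, Module.End.one_apply] at this
  rw [this]

lemma CS_tensor_left (A : Module.End k W) (B : Module.End k V) (C D : Module.End k U)
    (hCD : ∀ i, C ^ i * D ^ i = 1) (θ : V →ₗ[k] W) :
    CS p (TensorProduct.map C A : Module.End k (U ⊗[k] W)) (TensorProduct.map D B : Module.End k (U ⊗[k] V))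
      (TensorProduct.map LinearMap.id θ) = TensorProduct.map LinearMap.id (CS p A B θ) := by
  ext u v
  simp only [TensorProduct.AlgebraTensorModule.curry_apply, LinearMap.restrictScalars_self,
    TensorProduct.curry_apply, CS_apply, TensorProduct.map_tmul, TensorProduct.map_pow,
    LinearMap.id_apply, TensorProduct.tmul_sum]
  refine Finset.sum_congr rfl fun i _ => ?_
  have := LinearMap.congr_fun (hCD i) u
  simp only [Module.End.mul_apply, Module.End.one_apply] at this
  rw [this]

lemma inv_pow_pow (hp : 0 < p) (A : Module.End k W) (hA : A ^ p = 1) (i : ℕ) :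
    A ^ i * (A ^ (p-1)) ^ i = 1 := by
  rw [← pow_mul, ← pow_add]
  have : i + (p-1) * i = p * i := by
    obtain ⟨q, rfl⟩ : ∃ q, p = q + 1 := ⟨p-1, by omega⟩
    simp; ring
  rw [this, pow_mul, hA, one_pow]

end CS

/-- equivariance -/
def IsHom (X Y : RMod k p) (f : X.V →ₗ[k] Y.V) : Prop :=
  f ∘ₗ X.g = Y.g ∘ₗ f ∧ f ∘ₗ X.h = Y.h ∘ₗ f

noncomputable def Tr (X Y : RMod k p) (θ : X.V →ₗ[k] Y.V) : X.V →ₗ[k] Y.V :=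
  CS p Y.g (X.g ^ (p-1)) (CS p Y.h (X.h ^ (p-1)) θ)

variable {X Y Z W : RMod k p}

lemma IsHom.comp {f : X.V →ₗ[k] Y.V} {f' : Y.V →ₗ[k] Z.V} (hf' : IsHom Y Z f') (hf : IsHom X Y f) :
    IsHom X Z (f' ∘ₗ f) := by
  constructor
  · rw [LinearMap.comp_assoc, hf.1, ← LinearMap.comp_assoc, hf'.1, LinearMap.comp_assoc]
  · rw [LinearMap.comp_assoc, hf.2, ← LinearMap.comp_assoc, hf'.2, LinearMap.comp_assoc]

lemma IsHom.id : IsHom X X LinearMap.id := ⟨rfl, rfl⟩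

lemma IsHom.sub {f f' : X.V →ₗ[k] Y.V} (hf : IsHom X Y f) (hf' : IsHom X Y f') :
    IsHom X Y (f - f') := by
  constructor
  · rw [LinearMap.sub_comp, LinearMap.comp_sub, hf.1, hf'.1]
  · rw [LinearMap.sub_comp, LinearMap.comp_sub, hf.2, hf'.2]

lemma Tr_isHom (hp : 0 < p) (θ : X.V →ₗ[k] Y.V) : IsHom X Y (Tr X Y θ) := by
  constructor
  · exact CS_comm hp _ _ Y.gp X.gp _
  · unfold Tr
    have h1 := CS_comm hp _ _ Y.hp X.hp θ
    have h2 : X.h ∘ₗ (X.g ^ (p-1)) = (X.g ^ (p-1)) ∘ₗ X.h :=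
      (Commute.pow_right X.comm.symm _ : Commute X.h (X.g ^ (p-1)))
    rw [CS_right _ h2, h1]
    exact (CS_left (A := Y.g) (A' := Y.g) _ (f := Y.h) Y.comm.symm _).symm

lemma Tr_left {f : Y.V →ₗ[k] Z.V} (hf : IsHom Y Z f) (θ : X.V →ₗ[k] Y.V) :
    f ∘ₗ Tr X Y θ = Tr X Z (f ∘ₗ θ) := by
  unfold Tr
  rw [CS_left _ hf.1, CS_left _ hf.2]

lemma Tr_right {f : X.V →ₗ[k] Y.V} (hf : IsHom X Y f) (θ : Y.V →ₗ[k] Z.V) :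
    Tr Y Z θ ∘ₗ f = Tr X Z (θ ∘ₗ f) := by
  unfold Tr
  rw [CS_right _ (pow_intertwine hf.1 _), CS_right _ (pow_intertwine hf.2 _)]

lemma Tr_zero : Tr X Y 0 = 0 := by ext v; simp [Tr, CS]

lemma Tr_add (θ θ' : X.V →ₗ[k] Y.V) : Tr X Y (θ + θ') = Tr X Y θ + Tr X Y θ' := by
  ext v; simp [Tr, CS_apply, Finset.sum_add_distrib]

/-- Higman's criterion as a definition -/
def Proj (P : RMod k p) : Prop := ∃ θ, Tr P P θ = LinearMap.id

def Retr (X Y : RMod k p) : Prop :=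
  ∃ (i : X.V →ₗ[k] Y.V) (r : Y.V →ₗ[k] X.V), IsHom X Y i ∧ IsHom Y X r ∧ r ∘ₗ i = LinearMap.id

def SR (X Y : RMod k p) : Prop :=
  ∃ (i : X.V →ₗ[k] Y.V) (r : Y.V →ₗ[k] X.V) (θ : X.V →ₗ[k] X.V),
    IsHom X Y i ∧ IsHom Y X r ∧ r ∘ₗ i + Tr X X θ = LinearMap.id

lemma Retr.sr (h : Retr X Y) : SR X Y := by
  obtain ⟨i, r, hi, hr, hri⟩ := h
  exact ⟨i, r, 0, hi, hr, by rw [Tr_zero, hri, add_zero]⟩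

lemma Retr.refl (X : RMod k p) : Retr X X := ⟨_, _, IsHom.id, IsHom.id, rfl⟩

lemma Retr.trans (h : Retr X Y) (h' : Retr Y Z) : Retr X Z := by
  obtain ⟨i, r, hi, hr, hri⟩ := h
  obtain ⟨i', r', hi', hr', hri'⟩ := h'
  refine ⟨i' ∘ₗ i, r ∘ₗ r', hi'.comp hi, hr.comp hr', ?_⟩
  rw [LinearMap.comp_assoc, ← LinearMap.comp_assoc _ _ r', hri', LinearMap.id_comp, hri]

lemma SR.trans (h : SR X Y) (h' : SR Y Z) : SR X Z := by
  obtain ⟨i, r, θ, hi, hr, hri⟩ := h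
  obtain ⟨i', r', θ', hi', hr', hri'⟩ := h'
  refine ⟨i' ∘ₗ i, r ∘ₗ r', r ∘ₗ θ' ∘ₗ i + θ, hi'.comp hi, hr.comp hr', ?_⟩
  rw [Tr_add, ← Tr_left hr, ← Tr_right hi, ← hri]
  have : r' ∘ₗ i' = LinearMap.id - Tr Y Y θ' := by rw [← hri']; simp
  rw [LinearMap.comp_assoc, ← LinearMap.comp_assoc _ _ r', this, LinearMap.sub_comp,
    LinearMap.comp_sub, LinearMap.id_comp]
  abel

/-- tensor product -/
noncomputable def tens (X Y : RMod k p) : RMod k p where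
  V := X.V ⊗[k] Y.V
  g := TensorProduct.map X.g Y.g
  h := TensorProduct.map X.h Y.h
  gp := by rw [TensorProduct.map_pow, X.gp, Y.gp]; exact TensorProduct.map_one
  hp := by rw [TensorProduct.map_pow, X.hp, Y.hp]; exact TensorProduct.map_one
  comm := by rw [← TensorProduct.map_mul, ← TensorProduct.map_mul, X.comm, Y.comm]

lemma Tr_tens_right (hp : 0 < p) (Z : RMod k p) (θ : X.V →ₗ[k] Y.V) :
    Tr (tens X Z) (tens Y Z) (TensorProduct.map θ LinearMap.id)
      = TensorProduct.map (Tr X Y θ) LinearMap.id := by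
  unfold Tr tens
  simp only [TensorProduct.map_pow]
  rw [CS_tensor_right, CS_tensor_right]
  · exact inv_pow_pow hp _ Z.gp
  · exact inv_pow_pow hp _ Z.hp

lemma Tr_tens_left (hp : 0 < p) (Z : RMod k p) (θ : X.V →ₗ[k] Y.V) :
    Tr (tens Z X) (tens Z Y) (TensorProduct.map LinearMap.id θ)
      = TensorProduct.map LinearMap.id (Tr X Y θ) := by
  unfold Tr tens
  simp only [TensorProduct.map_pow]
  rw [CS_tensor_left, CS_tensor_left]
  · exact inv_pow_pow hp _ Z.gp
  · exact inv_pow_pow hp _ Z.hp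

lemma IsHom.tens {f : X.V →ₗ[k] Y.V} {f' : Z.V →ₗ[k] W.V} (hf : IsHom X Y f) (hf' : IsHom Z W f') :
    IsHom (tens X Z) (tens Y W) (TensorProduct.map f f') := by
  constructor
  · change TensorProduct.map f f' ∘ₗ TensorProduct.map X.g Z.g
      = TensorProduct.map Y.g W.g ∘ₗ TensorProduct.map f f'
    rw [← TensorProduct.map_comp, ← TensorProduct.map_comp, hf.1, hf'.1]
  · change TensorProduct.map f f' ∘ₗ TensorProduct.map X.h Z.h
      = TensorProduct.map Y.h W.h ∘ₗ TensorProduct.map f f'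
    rw [← TensorProduct.map_comp, ← TensorProduct.map_comp, hf.2, hf'.2]

lemma Retr.tens (h : Retr X Y) (h' : Retr Z W) : Retr (tens X Z) (tens Y W) := by
  obtain ⟨i, r, hi, hr, hri⟩ := h
  obtain ⟨i', r', hi', hr', hri'⟩ := h'
  refine ⟨TensorProduct.map i i', TensorProduct.map r r', hi.tens hi', hr.tens hr', ?_⟩
  change TensorProduct.map r r' ∘ₗ TensorProduct.map i i' = _
  rw [← TensorProduct.map_comp, hri, hri']; exact TensorProduct.map_id

lemma SR.tens_right (hp : 0 < p) (h : SR X Y) (Z : RMod k p) : SR (tens X Z) (tens Y Z) := by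
  obtain ⟨i, r, θ, hi, hr, hri⟩ := h
  refine ⟨TensorProduct.map i LinearMap.id, TensorProduct.map r LinearMap.id,
    TensorProduct.map θ LinearMap.id, hi.tens IsHom.id, hr.tens IsHom.id, ?_⟩
  rw [Tr_tens_right hp]
  change TensorProduct.map r LinearMap.id ∘ₗ TensorProduct.map i LinearMap.id + _ = _
  rw [← TensorProduct.map_comp, LinearMap.id_comp]
  have := TensorProduct.map_add_left (r ∘ₗ i) (Tr X X θ) (LinearMap.id : Z.V →ₗ[k] Z.V)
  rw [hri] at this
  rw [TensorProduct.map_id] at this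
  exact this.symm

lemma Proj.tens_left (hp : 0 < p) (h : Proj X) (Z : RMod k p) : Proj (tens Z X) := by
  obtain ⟨θ, h⟩ := h
  refine ⟨TensorProduct.map LinearMap.id θ, ?_⟩
  rw [Tr_tens_left hp, h]; exact TensorProduct.map_id

lemma Proj.tens_right (hp : 0 < p) (h : Proj X) (Z : RMod k p) : Proj (tens X Z) := by
  obtain ⟨θ, h⟩ := h
  refine ⟨TensorProduct.map θ LinearMap.id, ?_⟩
  rw [Tr_tens_right hp, h]; exact TensorProduct.map_id

/-- short exact sequences -/
structure SES (S P Q : RMod k p) (j : S.V →ₗ[k] P.V) (π : P.V →ₗ[k] Q.V) : Prop where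
  hj : IsHom S P j
  hπ : IsHom P Q π
  inj : Function.Injective j
  surj : Function.Surjective π
  ex : Function.Exact j π

lemma SES.retract {S P Q : RMod k p} {j : S.V →ₗ[k] P.V} {π : P.V →ₗ[k] Q.V}
    (h : SES S P Q j π) : ∃ ρ : P.V →ₗ[k] S.V, (∀ s, ρ (j s) = s) ∧
      (∀ x, π x = 0 → j (ρ x) = x) := by
  obtain ⟨ρ, hρ⟩ := j.exists_leftInverse_of_injective (LinearMap.ker_eq_bot.2 h.inj)
  have h1 : ∀ s, ρ (j s) = s := fun s => LinearMap.congr_fun hρ s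
  refine ⟨ρ, h1, fun x hx => ?_⟩
  obtain ⟨s, rfl⟩ := (h.ex x).1 hx
  rw [h1]

lemma SES.section {S P Q : RMod k p} {j : S.V →ₗ[k] P.V} {π : P.V →ₗ[k] Q.V}
    (h : SES S P Q j π) : ∃ σ : Q.V →ₗ[k] P.V, (∀ s, π (σ s) = s) := by
  obtain ⟨ρ, hρ⟩ := π.exists_rightInverse_of_surjective (LinearMap.range_eq_top.2 h.surj)
  exact ⟨ρ, fun s => LinearMap.congr_fun hρ s⟩

/-- corestriction of a hom killed by π -/
lemma SES.factor {S P Q : RMod k p} {j : S.V →ₗ[k] P.V} {π : P.V →ₗ[k] Q.V}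
    (h : SES S P Q j π) {f : X.V →ₗ[k] P.V} (hf : IsHom X P f) (h0 : ∀ x, π (f x) = 0) :
    ∃ f' : X.V →ₗ[k] S.V, IsHom X S f' ∧ ∀ x, j (f' x) = f x := by
  obtain ⟨ρ, h1, h2⟩ := h.retract
  have h3 : ∀ x, j ((ρ ∘ₗ f) x) = f x := fun x => h2 _ (h0 x)
  refine ⟨ρ ∘ₗ f, ⟨?_, ?_⟩, h3⟩
  · ext x; apply h.inj
    have e1 := LinearMap.congr_fun hf.1 x
    have e2 := LinearMap.congr_fun h.hj.1 ((ρ ∘ₗ f) x)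
    rw [LinearMap.comp_apply, h3]
    simp only [LinearMap.comp_apply] at *
    rw [e1, e2, h3]
  · ext x; apply h.inj
    have e1 := LinearMap.congr_fun hf.2 x
    have e2 := LinearMap.congr_fun h.hj.2 ((ρ ∘ₗ f) x)
    rw [LinearMap.comp_apply, h3]
    simp only [LinearMap.comp_apply] at *
    rw [e1, e2, h3]

lemma Proj.lift (hp : 0 < p) {S P Q P' : RMod k p} {j : S.V →ₗ[k] P.V} {π : P.V →ₗ[k] Q.V}
    (h : SES S P Q j π) (hP' : Proj P') {f : P'.V →ₗ[k] Q.V} (hf : IsHom P' Q f) :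
    ∃ a : P'.V →ₗ[k] P.V, IsHom P' P a ∧ ∀ x, π (a x) = f x := by
  obtain ⟨σ, hσ⟩ := h.section
  obtain ⟨θ, hθ⟩ := hP'
  refine ⟨Tr P' P (σ ∘ₗ f ∘ₗ θ), Tr_isHom hp _, fun x => ?_⟩
  have h1 := Tr_left (X := P') h.hπ (σ ∘ₗ f ∘ₗ θ)
  have h2 : π ∘ₗ σ ∘ₗ f ∘ₗ θ = f ∘ₗ θ := by ext x; simp [hσ]
  rw [h2, ← Tr_left hf, hθ] at h1
  exact LinearMap.congr_fun h1 x

lemma schanuel (hp : 0 < p) {S P Q S' P' : RMod k p} {j : S.V →ₗ[k] P.V} {π : P.V →ₗ[k] Q.V}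
    {j' : S'.V →ₗ[k] P'.V} {π' : P'.V →ₗ[k] Q.V} (h : SES S P Q j π) (h' : SES S' P' Q j' π')
    (hP : Proj P) (hP' : Proj P') : SR S S' := by
  obtain ⟨a, ha, ha'⟩ := Proj.lift hp h' hP h.hπ
  obtain ⟨b, hb, hb'⟩ := Proj.lift hp h hP' h'.hπ
  obtain ⟨i, hi, hi'⟩ := h'.factor (ha.comp h.hj) (fun x => by
    rw [LinearMap.comp_apply, ha']; exact (h.ex _).2 ⟨x, rfl⟩)
  obtain ⟨r, hr, hr'⟩ := h.factor (hb.comp h'.hj) (fun x => by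
    rw [LinearMap.comp_apply, hb']; exact (h'.ex _).2 ⟨x, rfl⟩)
  obtain ⟨c, hc, hc'⟩ := h.factor (IsHom.id.sub (hb.comp ha)) (fun x => by
    simp [hb', ha'])
  obtain ⟨θ, hθ⟩ := hP
  refine ⟨i, r, c ∘ₗ θ ∘ₗ j, hi, hr, ?_⟩
  rw [← Tr_left hc, ← Tr_right h.hj, hθ]
  ext x
  apply h.inj
  simp only [LinearMap.add_apply, LinearMap.comp_apply, LinearMap.id_apply, map_add, hr', hi', hc',
    LinearMap.sub_apply]
  abel

end basic
end SpNA


namespace SpNA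
open scoped TensorProduct

section cohom
variable {k : Type} [Field k] {p : ℕ}

noncomputable def RMod.x (N : RMod k p) : Module.End k N.V := N.g - 1
noncomputable def RMod.y (N : RMod k p) : Module.End k N.V := N.h - 1

section ops
variable [Fact p.Prime] [CharP k p] {V : Type} [AddCommGroup V] [Module k V]

lemma geom_eq (A : Module.End k V) : ∑ i ∈ Finset.range p, A ^ i = (A - 1) ^ (p-1) := by
  have hp : p.Prime := Fact.out
  have h : (∑ i ∈ Finset.range p, (Polynomial.X : Polynomial k) ^ i)
      = (Polynomial.X - 1) ^ (p-1) := by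
    have h0 : (Polynomial.X - 1 : Polynomial k) ≠ 0 := by
      simpa using Polynomial.X_sub_C_ne_zero (1 : k)
    apply mul_right_cancel₀ h0
    rw [geom_sum_mul, ← pow_succ, Nat.sub_add_cancel hp.one_le, sub_pow_char, one_pow]
  have := congrArg (Polynomial.aeval A) h
  simpa using this

lemma sub_pow_p (A : Module.End k V) (hA : A ^ p = 1) : (A - 1) ^ p = 0 := by
  have hp : p.Prime := Fact.out
  have h : ((Polynomial.X : Polynomial k) - 1) ^ p = Polynomial.X ^ p - 1 := by
    rw [sub_pow_char, one_pow]
  have := congrArg (Polynomial.aeval A) h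
  simp only [map_pow, map_sub, Polynomial.aeval_X, map_one, hA, sub_self] at this
  exact this

lemma CS_fixed (A B : Module.End k V) (θ : V →ₗ[k] V) {v : V} (hv : B v = v) :
    CS p A B θ v = ((A - 1) ^ (p-1)) (θ v) := by
  have hB : ∀ i, (B ^ i) v = v := by
    intro i; induction i with
    | zero => rfl
    | succ i ih => rw [pow_succ, Module.End.mul_apply, hv, ih]
  rw [CS_apply, ← geom_eq]
  simp [hB]

lemma fixed_pow (A : Module.End k V) {v : V} (hv : (A - 1) v = 0) (i : ℕ) : (A ^ i) v = v := by
  have hv' : A v = v := by simpa [sub_eq_zero] using hv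
  induction i with
  | zero => rfl
  | succ i ih => rw [pow_succ, Module.End.mul_apply, hv', ih]

lemma CS_norm (A : Module.End k V) (θ : V →ₗ[k] V) {v : V}
    (hv : ((A - 1) ^ (p-1)) v = 0) :
    CS p A (A ^ (p-1)) θ v = (A - 1) (∑ i ∈ Finset.range p, ∑ l ∈ Finset.range i,
      (A ^ l) (θ (((A ^ (p-1)) ^ i) v))) := by
  have h1 : ∑ i ∈ Finset.range p, ((A ^ (p-1)) ^ i) v = 0 := by
    have h2 := LinearMap.congr_fun (geom_eq (p := p) (A ^ (p-1))) v
    rw [LinearMap.sum_apply] at h2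
    rw [h2]
    have h3 := geom_sum_mul A (p-1)
    have hc : Commute (∑ i ∈ Finset.range (p-1), A ^ i) (A - 1) := by
      have := (Commute.sum_left (Finset.range (p-1)) (fun i => A ^ i) (A - 1) (fun i _ =>
        Commute.pow_left ((Commute.refl A).sub_right (Commute.one_right A)) i))
      exact this
    rw [← h3, hc.mul_pow, Module.End.mul_apply, hv, map_zero]
  rw [CS_apply, map_sum]
  have h4 : ∀ i, (A ^ i) (θ (((A ^ (p-1)) ^ i) v)) = (A - 1) (∑ l ∈ Finset.range i,
      (A ^ l) (θ (((A ^ (p-1)) ^ i) v))) + θ (((A ^ (p-1)) ^ i) v) := by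
    intro i
    have := LinearMap.congr_fun (mul_geom_sum A i) (θ (((A ^ (p-1)) ^ i) v))
    rw [Module.End.mul_apply, LinearMap.sum_apply] at this
    rw [this]; simp
  rw [Finset.sum_congr rfl (fun i _ => h4 i), Finset.sum_add_distrib, ← map_sum θ, h1]
  simp

end ops

/-- alternating operators -/
noncomputable def alt (p : ℕ) {V : Type} [AddCommGroup V] [Module k V] (x : Module.End k V) (a : ℕ) :
    Module.End k V := if Even a then x else x ^ (p-1)

lemma alt_alt (hp : 0 < p) {V : Type} [AddCommGroup V] [Module k V] (x : Module.End k V)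
    (hx : x ^ p = 0) (a : ℕ) (v : V) : alt p x (a+1) (alt p x a v) = 0 := by
  have h : alt p x (a+1) * alt p x a = 0 := by
    unfold alt
    by_cases h : Even a
    · have : ¬ Even (a+1) := by simpa [Nat.even_add_one] using h
      rw [if_neg this, if_pos h, ← pow_succ, Nat.sub_add_cancel hp, hx]
    · have : Even (a+1) := by simpa [Nat.even_add_one] using h
      rw [if_pos this, if_neg h, ← pow_succ', Nat.sub_add_cancel hp, hx]
  exact LinearMap.congr_fun h v

lemma alt_comm {V : Type} [AddCommGroup V] [Module k V] {x y : Module.End k V}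
    (hxy : Commute x y) (a b : ℕ) (v : V) : alt p x a (alt p y b v) = alt p y b (alt p x a v) := by
  have h : Commute (alt p x a) (alt p y b) := by
    unfold alt
    split_ifs
    · exact hxy
    · exact hxy.pow_right _
    · exact hxy.pow_left _
    · exact hxy.pow_pow _ _
  exact LinearMap.congr_fun h v

lemma alt_nat {V W : Type} [AddCommGroup V] [Module k V] [AddCommGroup W] [Module k W]
    {x : Module.End k V} {y : Module.End k W} {f : V →ₗ[k] W} (hf : f ∘ₗ x = y ∘ₗ f) (a : ℕ) (v : V) :
    f (alt p x a v) = alt p y a (f v) := by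
  unfold alt
  split_ifs
  · exact LinearMap.congr_fun hf v
  · exact LinearMap.congr_fun (pow_intertwine hf _) v

noncomputable def dd (N : RMod k p) : (ℕ → ℕ → N.V) →ₗ[k] (ℕ → ℕ → N.V) where
  toFun f a b := (match a with | 0 => 0 | a' + 1 => alt p N.x a' (f a' b)) +
    (match b with | 0 => 0 | b' + 1 => ((-1 : k) ^ a) • alt p N.y b' (f a b'))
  map_add' f f' := by
    ext a b
    cases a <;> cases b <;> simp <;> abel
  map_smul' c f := by
    ext a b
    cases a <;> cases b <;> simp [smul_comm c]

lemma dd_00 (N : RMod k p) (f) : dd N f 0 0 = 0 := by simp [dd]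
lemma dd_s0 (N : RMod k p) (f) (a : ℕ) : dd N f (a+1) 0 = alt p N.x a (f a 0) := by simp [dd]
lemma dd_0s (N : RMod k p) (f) (b : ℕ) : dd N f 0 (b+1) = alt p N.y b (f 0 b) := by simp [dd]
lemma dd_ss (N : RMod k p) (f) (a b : ℕ) : dd N f (a+1) (b+1) =
    alt p N.x a (f a (b+1)) + ((-1 : k) ^ (a+1)) • alt p N.y b (f (a+1) b) := by simp [dd]

lemma xy_comm (N : RMod k p) : Commute N.x N.y := by
  have : Commute N.g N.h := N.comm
  exact (this.sub_left (Commute.one_left _)).sub_right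
    ((Commute.one_right _))

lemma dd_dd [Fact p.Prime] [CharP k p] (N : RMod k p) (f) : dd N (dd N f) = 0 := by
  have hp : 0 < p := (Fact.out : p.Prime).pos
  have hx : ∀ a v, alt p N.x (a+1) (alt p N.x a v) = 0 := alt_alt hp _ (sub_pow_p _ N.gp)
  have hy : ∀ a v, alt p N.y (a+1) (alt p N.y a v) = 0 := alt_alt hp _ (sub_pow_p _ N.hp)
  ext a b
  rcases a with _ | _ | a <;> rcases b with _ | _ | b <;>
    simp only [dd_00, dd_s0, dd_0s, dd_ss, zero_add, map_zero, map_add, map_smul, hx, hy,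
      smul_zero, add_zero, Pi.zero_apply, alt_comm (xy_comm N).symm] <;>
    simp [pow_succ]

def mapC {V W : Type} [AddCommGroup V] [Module k V] [AddCommGroup W] [Module k W]
    (f : V →ₗ[k] W) : (ℕ → ℕ → V) →ₗ[k] (ℕ → ℕ → W) where
  toFun u a b := f (u a b)
  map_add' u v := by ext; simp
  map_smul' c u := by ext; simp

@[simp] lemma mapC_apply {V W : Type} [AddCommGroup V] [Module k V] [AddCommGroup W] [Module k W]
    (f : V →ₗ[k] W) (u : ℕ → ℕ → V) (a b : ℕ) : mapC f u a b = f (u a b) := rfl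

lemma dd_mapC {X Y : RMod k p} {f : X.V →ₗ[k] Y.V} (hf : IsHom X Y f) (u) :
    dd Y (mapC f u) = mapC f (dd X u) := by
  have hx : f ∘ₗ X.x = Y.x ∘ₗ f := by
    unfold RMod.x; rw [LinearMap.comp_sub, hf.1, LinearMap.sub_comp]; rfl
  have hy : f ∘ₗ X.y = Y.y ∘ₗ f := by
    unfold RMod.y; rw [LinearMap.comp_sub, hf.2, LinearMap.sub_comp]; rfl
  ext a b
  rcases a with _ | a <;> rcases b with _ | b <;>
    simp [dd_00, dd_s0, dd_0s, dd_ss, alt_nat hx, alt_nat hy]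

/-- cochains of degree `m - 1` -/
def Sm (V : Type) [AddCommGroup V] [Module k V] (m : ℕ) : Submodule k (ℕ → ℕ → V) where
  carrier := {u | ∀ a b, a + b + 1 ≠ m → u a b = 0}
  add_mem' hu hv a b h := by simp [hu a b h, hv a b h]
  zero_mem' a b h := rfl
  smul_mem' c u hu a b h := by simp [hu a b h]

lemma mem_Sm {V : Type} [AddCommGroup V] [Module k V] {m : ℕ} {u : ℕ → ℕ → V} :
    u ∈ Sm (k := k) V m ↔ ∀ a b, a + b + 1 ≠ m → u a b = 0 := Iff.rfl

lemma dd_mem {N : RMod k p} {m : ℕ} {u} (hu : u ∈ Sm (k := k) N.V m) :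
    dd N u ∈ Sm (k := k) N.V (m+1) := by
  rw [mem_Sm] at *
  intro a b hab
  rcases a with _ | a <;> rcases b with _ | b <;> simp only [dd_00, dd_s0, dd_0s, dd_ss]
  · rw [hu _ _ (by omega), map_zero]
  · rw [hu _ _ (by omega), map_zero]
  · rw [hu _ _ (by omega), hu _ _ (by omega), map_zero, map_zero, smul_zero, add_zero]

lemma mapC_mem {V W : Type} [AddCommGroup V] [Module k V] [AddCommGroup W] [Module k W]
    (f : V →ₗ[k] W) {m : ℕ} {u} (hu : u ∈ Sm (k := k) V m) : mapC f u ∈ Sm (k := k) W m := by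
  intro a b hab
  rw [mapC_apply, hu a b hab, map_zero]

/-- the `m`-th cohomology has dimension at most `c` -/
def Bd (m : ℕ) (N : RMod k p) (c : ℕ) : Prop :=
  ∃ (W : Type) (_ : AddCommGroup W) (_ : Module k W) (_ : FiniteDimensional k W)
    (L : (ℕ → ℕ → N.V) →ₗ[k] W), Module.finrank k W ≤ c ∧
    ∀ f ∈ Sm (k := k) N.V (m+1), dd N f = 0 → L f = 0 → ∃ u ∈ Sm (k := k) N.V m, dd N u = f

lemma Bd_zero (N : RMod k p) [FiniteDimensional k N.V] : Bd 0 N (Module.finrank k N.V) := by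
  refine ⟨N.V, inferInstance, inferInstance, inferInstance,
    { toFun := fun f => f 0 0, map_add' := fun _ _ => rfl, map_smul' := fun _ _ => rfl }, le_rfl, fun f hf _ h0 => ⟨0, Submodule.zero_mem _, ?_⟩⟩
  rw [map_zero]
  ext a b
  by_cases hab : a + b + 1 = 0 + 1
  · obtain ⟨rfl, rfl⟩ : a = 0 ∧ b = 0 := by omega
    exact h0.symm
  · exact (hf a b hab).symm

lemma pinv {A B : Type} [AddCommGroup A] [Module k A] [AddCommGroup B] [Module k B]
    (T : A →ₗ[k] B) : ∃ τ : B →ₗ[k] A, ∀ a, T (τ (T a)) = T a := by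
  obtain ⟨σ, hσ⟩ := T.rangeRestrict.exists_rightInverse_of_surjective T.range_rangeRestrict
  obtain ⟨τ, hτ⟩ := LinearMap.exists_extend σ
  refine ⟨τ, fun a => ?_⟩
  have h1 : τ (T a) = σ (T.rangeRestrict a) := LinearMap.congr_fun hτ (T.rangeRestrict a)
  rw [h1]
  have h2 := LinearMap.congr_fun hσ (T.rangeRestrict a)
  exact congrArg Subtype.val h2

lemma Bd_retr {m c : ℕ} {X Y : RMod k p} {i : X.V →ₗ[k] Y.V} {r : Y.V →ₗ[k] X.V}
    (hi : IsHom X Y i) (hr : IsHom Y X r)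
    (h : r ∘ₗ i = LinearMap.id) (hY : Bd m Y c) : Bd m X c := by
  obtain ⟨W, _, _, _, L, hW, hL⟩ := hY
  refine ⟨W, inferInstance, inferInstance, inferInstance, L ∘ₗ mapC i, hW, fun f hf hdf h0 => ?_⟩
  obtain ⟨u, hu, hdu⟩ := hL (mapC i f) (mapC_mem _ hf) (by rw [dd_mapC hi, hdf, map_zero]) h0
  refine ⟨mapC r u, mapC_mem _ hu, ?_⟩
  rw [dd_mapC hr, hdu]
  ext a b
  exact LinearMap.congr_fun h _

section LES
variable [Fact p.Prime] [CharP k p] {S P Q : RMod k p} {j : S.V →ₗ[k] P.V} {π : P.V →ₗ[k] Q.V}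

lemma mapC_inj (h : SES S P Q j π) : Function.Injective (mapC j) := by
  intro u v huv
  ext a b
  exact h.inj (congrFun (congrFun huv a) b)

lemma Bd_shift (h : SES S P Q j π) {m c : ℕ}
    (hP : ∀ f ∈ Sm (k := k) P.V (m+2), dd P f = 0 → ∃ u ∈ Sm (k := k) P.V (m+1), dd P u = f)
    (hQ : Bd m Q c) : Bd (m+1) S c := by
  obtain ⟨W, _, _, _, L, hW, hL⟩ := hQ
  obtain ⟨ρ, h1, h2⟩ := h.retract
  obtain ⟨σ, hσ⟩ := h.section
  obtain ⟨τ, hτ⟩ := pinv ((dd P).domRestrict (Sm (k := k) P.V (m+1)))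
  refine ⟨W, inferInstance, inferInstance, inferInstance,
    L ∘ₗ mapC π ∘ₗ (Submodule.subtype _) ∘ₗ τ ∘ₗ mapC j, hW, fun f hf hdf h0 => ?_⟩
  obtain ⟨u', hu', hdu'⟩ := hP (mapC j f) (mapC_mem _ hf) (by rw [dd_mapC h.hj, hdf, map_zero])
  have h3 := hτ ⟨u', hu'⟩
  simp only [LinearMap.domRestrict_apply] at h3
  rw [hdu'] at h3
  set u := τ (mapC j f) with hu
  have hπj : ∀ f, mapC π (mapC j f) = 0 := by
    intro f; ext a b; exact (h.ex _).2 ⟨_, rfl⟩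
  obtain ⟨v, hv, hdv⟩ := hL (mapC π u) (mapC_mem _ u.2) (by
    rw [dd_mapC h.hπ, h3]; exact hπj f) h0
  have h4 : mapC π (u - dd P (mapC σ v)) = 0 := by
    rw [map_sub, ← dd_mapC h.hπ]
    have : mapC π (mapC σ v) = v := by ext a b; exact hσ _
    rw [this, hdv, sub_self]
  have h5 : mapC j (mapC ρ (u - dd P (mapC σ v))) = u - dd P (mapC σ v) := by
    ext a b
    exact h2 _ (congrFun (congrFun h4 a) b)
  refine ⟨mapC ρ (u - dd P (mapC σ v)), mapC_mem _ (Submodule.sub_mem _ u.2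
    (dd_mem (mapC_mem _ hv))), ?_⟩
  apply mapC_inj h
  rw [← dd_mapC h.hj, h5, map_sub, dd_dd, sub_zero, h3]

lemma Bd_quot (h : SES S P Q j π) {m c c' : ℕ} (hP : Bd m P c) (hS : Bd (m+1) S c') :
    Bd m Q (c + c') := by
  obtain ⟨W, _, _, _, L, hW, hL⟩ := hP
  obtain ⟨W', _, _, _, L', hW', hL'⟩ := hS
  obtain ⟨ρ, h1, h2⟩ := h.retract
  obtain ⟨σ, hσ⟩ := h.section
  obtain ⟨τ, hτ⟩ := pinv ((dd S).domRestrict (Sm (k := k) S.V (m+1)))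
  let s := mapC ρ ∘ₗ dd P ∘ₗ mapC σ
  refine ⟨W × W', inferInstance, inferInstance, inferInstance,
    LinearMap.prod (L ∘ₗ (mapC σ - mapC j ∘ₗ (Submodule.subtype _) ∘ₗ τ ∘ₗ s)) (L' ∘ₗ s),
    by rw [Module.finrank_prod]; omega, fun f hf hdf h0 => ?_⟩
  obtain ⟨h0, h0'⟩ := Prod.ext_iff.1 h0
  have hπσ : mapC π (mapC σ f) = f := by ext a b; exact hσ _
  have hjs : mapC j (s f) = dd P (mapC σ f) := by
    have : mapC π (dd P (mapC σ f)) = 0 := by rw [← dd_mapC h.hπ, hπσ, hdf]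
    ext a b
    exact h2 _ (congrFun (congrFun this a) b)
  have hsm : s f ∈ Sm (k := k) S.V (m+1+1) := mapC_mem _ (dd_mem (mapC_mem _ hf))
  obtain ⟨w', hw', hdw'⟩ := hL' (s f) hsm (by
    apply mapC_inj h; rw [← dd_mapC h.hj, hjs, dd_dd, map_zero]) h0'
  have h3 := hτ ⟨w', hw'⟩
  simp only [LinearMap.domRestrict_apply] at h3
  rw [hdw'] at h3
  set w := τ (s f) with hw
  obtain ⟨v, hv, hdv⟩ := hL (mapC σ f - mapC j w) (Submodule.sub_mem _ (mapC_mem _ hf)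
    (mapC_mem _ w.2)) (by rw [map_sub, dd_mapC h.hj, h3, hjs, sub_self]) h0
  refine ⟨mapC π v, mapC_mem _ hv, ?_⟩
  have hπj : ∀ f, mapC π (mapC j f) = 0 := by
    intro f; ext a b; exact (h.ex _).2 ⟨_, rfl⟩
  rw [dd_mapC h.hπ, hdv, map_sub, hπj, hπσ, sub_zero]

end LES

/-- exactness in the `y` direction -/
def YEx (N : RMod k p) : Prop := ∀ b v, alt p N.y (b+1) v = 0 → ∃ w, v = alt p N.y b w

lemma clear_y [Fact p.Prime] [CharP k p] {N : RMod k p} (hN : YEx N) {m : ℕ} (β : ℕ) :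
    ∀ f ∈ Sm (k := k) N.V (m+1), dd N f = 0 → (∀ a b, β < b → f a b = 0) →
    ∃ u ∈ Sm (k := k) N.V m, ∀ a b, 0 < b → (f - dd N u) a b = 0 := by
  induction β with
  | zero => exact fun f hf hdf hb => ⟨0, Submodule.zero_mem _, fun a b h => by
      rw [map_zero, sub_zero]; exact hb a b h⟩
  | succ β ih =>
    intro f hf hdf hb
    by_cases hm : m < β + 1
    · refine ih f hf hdf fun a b hab => hf a b (by omega)
    obtain ⟨a, ha⟩ : ∃ a, a + β + 1 = m := ⟨m - (β+1), by omega⟩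
    have h1 : alt p N.y (β+1) (f a (β+1)) = 0 := by
      have := congrFun (congrFun hdf a) (β+2)
      rcases a with _ | a
      · rw [dd_0s] at this; exact this
      · rw [dd_ss, hb _ (β+1+1) (by omega), map_zero, zero_add] at this
        simpa using this
    obtain ⟨w, hw⟩ := hN _ _ h1
    let u0 : ℕ → ℕ → N.V := fun a' b' => if a' = a ∧ b' = β then ((-1 : k) ^ a) • w else 0
    have hu0 : u0 ∈ Sm (k := k) N.V m := by
      intro a' b' hab
      have : ¬ (a' = a ∧ b' = β) := by rintro ⟨rfl, rfl⟩; omega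
      simp only [u0, if_neg this]
    have hneg : ∀ a : ℕ, ((-1 : k) ^ a) * ((-1 : k) ^ a) = 1 := by
      intro a; rw [← mul_pow]; simp
    obtain ⟨u, hu, hu'⟩ := ih (f - dd N u0) (Submodule.sub_mem _ hf (dd_mem hu0))
      (by rw [map_sub, hdf, dd_dd, sub_zero]) (by
        intro a' b' hb'
        by_cases hab : a' + b' + 1 = m + 1
        · rcases b' with _ | b'
          · omega
          by_cases hbb : b' = β
          · subst hbb
            obtain rfl : a' = a := by omega
            rcases a' with _ | a'
            · simp [dd_0s, u0, hw]
            · simp [dd_ss, u0, hw, smul_smul, hneg]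
          · have e1 : f a' (b'+1) = 0 := hb _ _ (by omega)
            have e2 : ∀ c, u0 c (b'+1) = 0 := fun c => by
              simp only [u0]; rw [if_neg]; omega
            have e3 : ∀ c, u0 c b' = 0 := fun c => by
              simp only [u0]; rw [if_neg]; omega
            rcases a' with _ | a'
            · simp [dd_0s, e1, e3]
            · simp [dd_ss, e1, e2, e3]
        · exact (Submodule.sub_mem _ hf (dd_mem hu0)) _ _ hab)
    refine ⟨u0 + u, Submodule.add_mem _ hu0 hu, fun a b h => ?_⟩
    rw [map_add, ← sub_sub]; exact hu' a b h

lemma clear_y' [Fact p.Prime] [CharP k p] {N : RMod k p} (hN : YEx N) {m : ℕ} :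
    ∀ f ∈ Sm (k := k) N.V (m+1), dd N f = 0 →
    ∃ u ∈ Sm (k := k) N.V m, ∀ a b, (0 < b ∨ a ≠ m) → (f - dd N u) a b = 0 := by
  intro f hf hdf
  obtain ⟨u, hu, h⟩ := clear_y hN m f hf hdf (fun a b hab => hf a b (by omega))
  refine ⟨u, hu, fun a b hab => ?_⟩
  by_cases hb : 0 < b
  · exact h a b hb
  · exact (Submodule.sub_mem _ hf (dd_mem hu)) _ _ (by omega)

/-- bound for `YEx` modules -/
lemma Bd_YEx [Fact p.Prime] [CharP k p] {N : RMod k p} [FiniteDimensional k N.V] (hN : YEx N)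
    (m : ℕ) : Bd m N (Module.finrank k N.V) := by
  let B : Submodule k (ℕ → ℕ → N.V) := (Sm (k := k) N.V m).map (dd N)
  let φ : N.V →ₗ[k] (ℕ → ℕ → N.V) :=
    { toFun := fun v a b => if a = m ∧ b = 0 then v else 0
      map_add' := by intro v w; ext a b; simp only [Pi.add_apply]; split_ifs <;> simp
      map_smul' := by intro c w; ext a b; simp only [Pi.smul_apply, RingHom.id_apply]; split_ifs <;> simp }
  let R := LinearMap.range (B.mkQ ∘ₗ φ)
  obtain ⟨q, hq⟩ := R.subtype.exists_leftInverse_of_injective (by simp)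
  refine ⟨R, inferInstance, inferInstance, inferInstance, q ∘ₗ B.mkQ, ?_, fun f hf hdf h0 => ?_⟩
  · exact LinearMap.finrank_range_le _
  · obtain ⟨u, hu, hu'⟩ := clear_y' hN f hf hdf
    have h1 : B.mkQ f = (B.mkQ ∘ₗ φ) ((f - dd N u) m 0) := by
      rw [LinearMap.comp_apply, ← sub_eq_zero, ← map_sub, Submodule.mkQ_apply,
        Submodule.Quotient.mk_eq_zero]
      refine ⟨u, hu, ?_⟩
      ext a b
      by_cases hab : a = m ∧ b = 0
      · obtain ⟨rfl, rfl⟩ := hab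
        simp [φ]
      · have h3 := hu' a b (by omega)
        have h4 : φ ((f - dd N u) m 0) a b = 0 := if_neg hab
        simp only [Pi.sub_apply] at h3 h4 ⊢
        rw [h4, sub_zero, (sub_eq_zero.1 h3)]
    have h2 : B.mkQ f = 0 := by
      have := LinearMap.congr_fun hq ⟨B.mkQ f, ⟨_, h1.symm⟩⟩
      simp only [LinearMap.comp_apply] at this h0
      rw [Submodule.subtype_apply, h0] at this
      exact congrArg Subtype.val this.symm
    rw [Submodule.mkQ_apply, Submodule.Quotient.mk_eq_zero] at h2
    exact h2

lemma alt_even {V : Type} [AddCommGroup V] [Module k V] (x : Module.End k V) {a : ℕ} (h : Even a) :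
    alt p x a = x := if_pos h
lemma alt_odd {V : Type} [AddCommGroup V] [Module k V] (x : Module.End k V) {a : ℕ} (h : ¬ Even a) :
    alt p x a = x ^ (p-1) := if_neg h

lemma alt_ex {V : Type} [AddCommGroup V] [Module k V] (x : Module.End k V)
    {R R' : V → Prop}
    (h1 : ∀ v, R v → x v = 0 → ∃ w, v = (x ^ (p-1)) w ∧ R' w)
    (h2 : ∀ v, R v → (x ^ (p-1)) v = 0 → ∃ w, v = x w ∧ R' w) (b : ℕ) (v : V) (hR : R v)
    (hv : alt p x (b+1) v = 0) : ∃ w, v = alt p x b w ∧ R' w := by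
  by_cases hb : Even b
  · have hb' : ¬ Even (b+1) := by simpa [Nat.even_add_one] using hb
    rw [alt_odd _ hb'] at hv; rw [alt_even _ hb]; exact h2 v hR hv
  · have hb' : Even (b+1) := by simpa [Nat.even_add_one] using hb
    rw [alt_even _ hb'] at hv; rw [alt_odd _ hb]; exact h1 v hR hv

lemma Proj.YEx [Fact p.Prime] [CharP k p] {N : RMod k p} (hN : Proj N) : YEx N := by
  obtain ⟨θ, hθ⟩ := hN
  have hc : Commute N.g N.h := N.comm
  have hgy : ∀ i, Commute (N.g ^ i) N.y := fun i =>
    (hc.sub_right (Commute.one_right _)).pow_left i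
  have hv0 : ∀ v, v = ∑ i ∈ Finset.range p, (N.g ^ i) (CS p N.h (N.h ^ (p-1)) θ
      (((N.g ^ (p-1)) ^ i) v)) := by
    intro v
    have := LinearMap.congr_fun hθ v
    rw [Tr, CS_apply] at this
    exact this.symm
  intro b v hv
  have := alt_ex (p := p) N.y (R := fun _ => True) (R' := fun _ => True) ?_ ?_ b v trivial hv
  · obtain ⟨w, hw, _⟩ := this; exact ⟨w, hw⟩
  · intro v _ hv
    refine ⟨∑ i ∈ Finset.range p, (N.g ^ i) (θ (((N.g ^ (p-1)) ^ i) v)), ?_, trivial⟩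
    conv_lhs => rw [hv0 v]
    rw [map_sum]
    refine Finset.sum_congr rfl fun i _ => ?_
    have e1 : N.y (((N.g ^ (p-1)) ^ i) v) = 0 := by
      rw [← pow_mul]
      have := LinearMap.congr_fun (hgy ((p-1)*i)) v
      simp only [Module.End.mul_apply] at this
      rw [← this, hv, map_zero]
    rw [CS_fixed _ _ _ (fixed_pow _ e1 _)]
    exact LinearMap.congr_fun ((hgy i).pow_right (p-1)) _
  · intro v _ hv
    refine ⟨∑ i ∈ Finset.range p, (N.g ^ i) (∑ l ∈ Finset.range p, ∑ l' ∈ Finset.range l,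
      (N.h ^ l') (θ (((N.h ^ (p-1)) ^ l) (((N.g ^ (p-1)) ^ i) v)))), ?_, trivial⟩
    conv_lhs => rw [hv0 v]
    rw [map_sum]
    refine Finset.sum_congr rfl fun i _ => ?_
    have e1 : ((N.h - 1) ^ (p-1)) (((N.g ^ (p-1)) ^ i) v) = 0 := by
      rw [← pow_mul]
      have := LinearMap.congr_fun ((hgy ((p-1)*i)).pow_right (p-1)) v
      simp only [Module.End.mul_apply] at this
      change (N.y ^ (p-1)) _ = 0
      rw [← this, hv, map_zero]
    rw [CS_norm _ _ e1]
    exact LinearMap.congr_fun (hgy i) _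

lemma Proj.XEx [Fact p.Prime] [CharP k p] {N : RMod k p} (hN : Proj N) (a : ℕ) (v : N.V)
    (hy : N.y v = 0) (hv : alt p N.x (a+1) v = 0) : ∃ w, v = alt p N.x a w ∧ N.y w = 0 := by
  obtain ⟨θ, hθ⟩ := hN
  have hp : 0 < p := (Fact.out : p.Prime).pos
  have hc : Commute N.g N.h := N.comm
  have hgy : ∀ i v, N.y v = 0 → N.y ((N.g ^ i) v) = 0 := fun i v hv => by
    have := LinearMap.congr_fun ((hc.sub_right (Commute.one_right _)).pow_left i) v
    simp only [Module.End.mul_apply] at this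
    change (N.h - 1) _ = 0
    rw [← this]
    change (N.g ^ i) (N.y v) = 0
    rw [hv, map_zero]
  set θ1 := CS p N.h (N.h ^ (p-1)) θ with hθ1
  have hθy : ∀ v, N.y v = 0 → N.y (θ1 v) = 0 := by
    intro v hv
    have h1 := LinearMap.congr_fun (CS_comm hp _ _ N.hp N.hp θ) v
    simp only [LinearMap.comp_apply] at h1
    have h2 : N.h v = v := by simpa [RMod.y, sub_eq_zero] using hv
    rw [h2] at h1
    simp only [RMod.y, LinearMap.sub_apply, Module.End.one_apply]
    rw [hθ1, ← h1, sub_self]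
  have hv0 : ∀ v, v = CS p N.g (N.g ^ (p-1)) θ1 v := fun v => (LinearMap.congr_fun hθ v).symm
  refine alt_ex (p := p) N.x (R := fun v => N.y v = 0) (R' := fun v => N.y v = 0) ?_ ?_ a v hy hv
  · intro v hy hv
    refine ⟨θ1 v, ?_, hθy v hy⟩
    conv_lhs => rw [hv0 v]
    exact CS_fixed _ _ _ (fixed_pow _ hv _)
  · intro v hy hv
    have := CS_norm (p := p) N.g θ1 (v := v) hv
    rw [← hv0] at this
    refine ⟨_, this, ?_⟩
    rw [map_sum]
    refine Finset.sum_eq_zero fun i _ => ?_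
    rw [map_sum]
    refine Finset.sum_eq_zero fun l _ => ?_
    refine hgy _ _ (hθy _ ?_)
    rw [← pow_mul]; exact hgy _ _ hy

lemma Proj.acyclic [Fact p.Prime] [CharP k p] {P : RMod k p} (hP : Proj P) (m : ℕ) :
    ∀ f ∈ Sm (k := k) P.V (m+2), dd P f = 0 → ∃ u ∈ Sm (k := k) P.V (m+1), dd P u = f := by
  intro f hf hdf
  obtain ⟨u, hu, h⟩ := clear_y' hP.YEx f hf hdf
  set f' := f - dd P u with hf'
  have hdf' : dd P f' = 0 := by rw [hf', map_sub, hdf, dd_dd, sub_zero]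
  have h1 : P.y (f' (m+1) 0) = 0 := by
    have := congrFun (congrFun hdf' (m+1)) 1
    rw [dd_ss, h m (0+1) (by omega), map_zero, zero_add, alt_even _ (by simp)] at this
    simpa using this
  have h2 : alt p P.x (m+1) (f' (m+1) 0) = 0 := by
    have := congrFun (congrFun hdf' (m+2)) 0
    rwa [dd_s0] at this
  obtain ⟨w, hw, hw'⟩ := hP.XEx m _ h1 h2
  let u0 : ℕ → ℕ → P.V := fun a' b' => if a' = m ∧ b' = 0 then w else 0
  have hu0 : u0 ∈ Sm (k := k) P.V (m+1) := by
    intro a' b' hab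
    have : ¬ (a' = m ∧ b' = 0) := by rintro ⟨rfl, rfl⟩; omega
    simp only [u0, if_neg this]
  refine ⟨u0 + u, Submodule.add_mem _ hu0 hu, ?_⟩
  rw [map_add, ← eq_sub_iff_add_eq, ← hf']
  have hyu : ∀ c, P.y (u0 c 0) = 0 := by
    intro c; simp only [u0]; split_ifs
    · exact hw'
    · exact map_zero _
  have hus : ∀ c d, u0 c (d+1) = 0 := by
    intro c d; simp [u0]
  ext a b
  rcases b with _ | b
  · rcases a with _ | a
    · rw [dd_00, h 0 0 (by omega)]
    · rw [dd_s0]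
      by_cases ham : a = m
      · subst ham; rw [hw]; simp [u0]
      · rw [h (a+1) 0 (by omega)]; simp [u0, ham]
  · rw [h a (b+1) (by omega)]
    have e : alt p P.y b (u0 a b) = 0 := by
      rcases b with _ | b
      · rw [alt_even _ (by simp)]; exact hyu a
      · rw [hus, map_zero]
    rcases a with _ | a
    · rw [dd_0s, e]
    · rw [dd_ss, hus, e]; simp

/-- trivial modules have large cohomology -/
lemma Bd_triv {N : RMod k p} (hp : 2 ≤ p) (hg : N.g = 1) (hh : N.h = 1) (v : N.V) (hv : v ≠ 0) {m c : ℕ}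
    (h : Bd m N c) : m + 1 ≤ c := by
  obtain ⟨W, _, _, _, L, hW, hL⟩ := h
  have hx : ∀ a w, alt p N.x a w = 0 := by
    intro a w
    have : N.x = 0 := by simp [RMod.x, hg]
    unfold alt; rw [this, zero_pow (by omega)]; split_ifs <;> rfl
  have hy : ∀ a w, alt p N.y a w = 0 := by
    intro a w
    have : N.y = 0 := by simp [RMod.y, hh]
    unfold alt; rw [this, zero_pow (by omega)]; split_ifs <;> rfl
  have hd : ∀ f, dd N f = 0 := by
    intro f; ext a b
    rcases a with _ | a <;> rcases b with _ | b <;> simp [dd_00, dd_s0, dd_0s, dd_ss, hx, hy]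
  let φ : (Fin (m+1) → k) →ₗ[k] (ℕ → ℕ → N.V) :=
    { toFun := fun t a b => if h : a < m + 1 ∧ a + b = m then t ⟨a, h.1⟩ • v else 0
      map_add' := by intro s t; ext a b; simp only [Pi.add_apply]; split_ifs <;> simp [add_smul]
      map_smul' := by
        intro s t; ext a b; simp only [Pi.smul_apply, RingHom.id_apply]; split_ifs <;> simp [mul_smul] }
  have hinj : Function.Injective (L ∘ₗ φ) := by
    rw [← LinearMap.ker_eq_bot, LinearMap.ker_eq_bot']
    intro t ht
    obtain ⟨u, _, hu⟩ := hL (φ t) (by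
      intro a b hab
      simp only [φ, LinearMap.coe_mk, AddHom.coe_mk]
      rw [dif_neg]; omega) (hd _) ht
    rw [hd] at hu
    ext i
    have := congrFun (congrFun hu i.1) (m - i.1)
    simp only [φ, LinearMap.coe_mk, AddHom.coe_mk] at this
    rw [dif_pos ⟨i.2, by omega⟩] at this
    simpa [hv] using this.symm
  have := LinearMap.finrank_le_finrank_of_injective hinj
  simp at this
  omega

end cohom
end SpNA


namespace SpNA
open scoped TensorProduct

section mono
variable {k : Type} [Field k] {p : ℕ}

/-- finite order ideals -/
structure Dn (p : ℕ) where
  S : ℕ → ℕ → Prop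
  dx : ∀ a b, S (a+1) b → S a b
  dy : ∀ a b, S a (b+1) → S a b
  bx : ∀ a b, S a b → a < p
  by' : ∀ a b, S a b → b < p

def Fn (k : Type) [Field k] (S : ℕ → ℕ → Prop) : Submodule k (ℕ → ℕ → k) where
  carrier := {f | ∀ a b, ¬ S a b → f a b = 0}
  add_mem' hu hv a b h := by simp [hu a b h, hv a b h]
  zero_mem' a b h := rfl
  smul_mem' c u hu a b h := by simp [hu a b h]

lemma mem_Fn {S : ℕ → ℕ → Prop} {f : ℕ → ℕ → k} : f ∈ Fn k S ↔ ∀ a b, ¬ S a b → f a b = 0 := Iff.rfl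

def shx : (ℕ → ℕ → k) →ₗ[k] (ℕ → ℕ → k) where
  toFun f a b := f (a+1) b
  map_add' _ _ := rfl
  map_smul' _ _ := rfl

def shy : (ℕ → ℕ → k) →ₗ[k] (ℕ → ℕ → k) where
  toFun f a b := f a (b+1)
  map_add' _ _ := rfl
  map_smul' _ _ := rfl

lemma shx_mem (S : Dn p) (f) (hf : f ∈ Fn k S.S) : shx f ∈ Fn k S.S :=
  fun a b h => hf _ _ (fun h' => h (S.dx _ _ h'))
lemma shy_mem (S : Dn p) (f) (hf : f ∈ Fn k S.S) : shy f ∈ Fn k S.S :=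
  fun a b h => hf _ _ (fun h' => h (S.dy _ _ h'))

noncomputable def mx (k : Type) [Field k] (S : Dn p) : Module.End k (Fn k S.S) := shx.restrict (shx_mem S)
noncomputable def my (k : Type) [Field k] (S : Dn p) : Module.End k (Fn k S.S) := shy.restrict (shy_mem S)

lemma mx_apply (S : Dn p) (f : Fn k S.S) (a b) : (mx k S f).1 a b = f.1 (a+1) b := rfl
lemma my_apply (S : Dn p) (f : Fn k S.S) (a b) : (my k S f).1 a b = f.1 a (b+1) := rfl

lemma mx_pow (S : Dn p) (f : Fn k S.S) (n a b) : ((mx k S ^ n) f).1 a b = f.1 (a+n) b := by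
  induction n generalizing f with
  | zero => rfl
  | succ n ih => rw [pow_succ, Module.End.mul_apply, ih, mx_apply]; rfl
lemma my_pow (S : Dn p) (f : Fn k S.S) (n a b) : ((my k S ^ n) f).1 a b = f.1 a (b+n) := by
  induction n generalizing f with
  | zero => rfl
  | succ n ih => rw [pow_succ, Module.End.mul_apply, ih, my_apply]; rfl

lemma add_pow_p [Fact p.Prime] [CharP k p] {V : Type} [AddCommGroup V] [Module k V]
    (A : Module.End k V) (hA : A ^ p = 0) : (1 + A) ^ p = 1 := by
  have h : (1 + (Polynomial.X : Polynomial k)) ^ p = 1 + Polynomial.X ^ p := by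
    rw [add_pow_char, one_pow]
  have := congrArg (Polynomial.aeval A) h
  simpa [hA] using this

lemma mx_pow_p (S : Dn p) : mx k S ^ p = 0 := by
  ext f a b
  rw [mx_pow]
  exact f.2 _ _ (fun h => by have := S.bx _ _ h; omega)
lemma my_pow_p (S : Dn p) : my k S ^ p = 0 := by
  ext f a b
  rw [my_pow]
  exact f.2 _ _ (fun h => by have := S.by' _ _ h; omega)

lemma RMod.cm (N : RMod k p) : Commute N.g N.h := N.comm

lemma SES.congr {S P Q Q' : RMod k p} {j : S.V →ₗ[k] P.V} {π : P.V →ₗ[k] Q.V} (h : SES S P Q j π)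
    (e : Q.V ≃ₗ[k] Q'.V) (he : IsHom Q Q' e.toLinearMap) : SES S P Q' j (e.toLinearMap ∘ₗ π) where
  hj := h.hj
  hπ := he.comp h.hπ
  inj := h.inj
  surj := e.surjective.comp h.surj
  ex v := by
    rw [← h.ex]
    simp

variable [Fact p.Prime] [CharP k p]

@[reducible] noncomputable def mon (k : Type) [Field k] [CharP k p] (S : Dn p) : RMod k p where
  V := Fn k S.S
  g := 1 + mx k S
  h := 1 + my k S
  gp := add_pow_p _ (mx_pow_p S)
  hp := add_pow_p _ (my_pow_p S)
  comm := by
    have : Commute (mx k S) (my k S) := by ext; rfl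
    exact (Commute.one_left _).add_left ((Commute.one_right _).add_right this)

lemma mon_g (S : Dn p) (f : Fn k S.S) (a b : ℕ) :
    (show Fn k S.S from (mon k S).g f).1 a b = f.1 a b + f.1 (a+1) b := rfl
lemma mon_h (S : Dn p) (f : Fn k S.S) (a b : ℕ) :
    (show Fn k S.S from (mon k S).h f).1 a b = f.1 a b + f.1 a (b+1) := rfl
lemma mon_x (S : Dn p) : (mon k S).x = mx k S := add_sub_cancel_left _ _
lemma mon_y (S : Dn p) : (mon k S).y = my k S := add_sub_cancel_left _ _

instance mon_fd (S : Dn p) : FiniteDimensional k (mon k S).V := by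
  let φ : (mon k S).V →ₗ[k] (Fin p → Fin p → k) :=
    { toFun := fun f i j => (show Fn k S.S from f).1 i j
      map_add' := fun _ _ => rfl
      map_smul' := fun _ _ => rfl }
  refine FiniteDimensional.of_injective φ ?_
  intro f f' h
  refine Subtype.ext (funext fun a => funext fun b => ?_)
  by_cases hab : S.S a b
  · exact congrFun (congrFun h ⟨a, S.bx _ _ hab⟩) ⟨b, S.by' _ _ hab⟩
  · exact (f.2 _ _ hab).trans (f'.2 _ _ hab).symm

/-- restriction of a linear map commuting with shifts -/
noncomputable def mmap (S S' : Dn p) (φ : (ℕ → ℕ → k) →ₗ[k] (ℕ → ℕ → k))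
    (h : ∀ f ∈ Fn k S.S, φ f ∈ Fn k S'.S) : (mon k S).V →ₗ[k] (mon k S').V := φ.restrict h

lemma mmap_hom (S S' : Dn p) (φ : (ℕ → ℕ → k) →ₗ[k] (ℕ → ℕ → k))
    (h : ∀ f ∈ Fn k S.S, φ f ∈ Fn k S'.S) (hx : ∀ f, φ (shx f) = shx (φ f))
    (hy : ∀ f, φ (shy f) = shy (φ f)) : IsHom (mon k S) (mon k S') (mmap S S' φ h) := by
  constructor
  · refine LinearMap.ext fun f => Subtype.ext ?_
    change φ (f.1 + shx f.1) = φ f.1 + shx (φ f.1)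
    rw [map_add, hx]
  · refine LinearMap.ext fun f => Subtype.ext ?_
    change φ (f.1 + shy f.1) = φ f.1 + shy (φ f.1)
    rw [map_add, hy]

@[reducible] def triv (p : ℕ) (k V : Type) [Field k] [AddCommGroup V] [Module k V] : RMod k p where
  V := V
  g := 1
  h := 1
  gp := one_pow _
  hp := one_pow _
  comm := rfl

lemma ses_top (S S' : Dn p) {ι : Type} (u v : ι → ℕ) (huv : ∀ i i', u i = u i' → v i = v i' → i = i')
    (hS : ∀ a b, S.S a b ↔ S'.S a b ∨ ∃ i, a = u i ∧ b = v i)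
    (h0 : ∀ i, ¬ S'.S (u i) (v i)) (h1 : ∀ i, ¬ S.S (u i + 1) (v i)) (h2 : ∀ i, ¬ S.S (u i) (v i + 1)) :
    ∃ j π, SES (mon k S') (mon k S) (triv p k (ι → k)) j π := by
  classical
  refine ⟨mmap S' S LinearMap.id (fun f hf a b h => hf a b fun h' => h ((hS _ _).2 (Or.inl h'))),
    { toFun := fun f i => (show Fn k S.S from f).1 (u i) (v i)
      map_add' := fun _ _ => rfl
      map_smul' := fun _ _ => rfl }, mmap_hom _ _ _ _ (fun _ => rfl) (fun _ => rfl), ?_, ?_, ?_, ?_⟩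
  · constructor
    · refine LinearMap.ext fun f => funext fun i => ?_
      change f.1 _ _ + f.1 _ _ = f.1 _ _
      rw [f.2 _ _ (h1 i), add_zero]
    · refine LinearMap.ext fun f => funext fun i => ?_
      change f.1 _ _ + f.1 _ _ = f.1 _ _
      rw [f.2 _ _ (h2 i), add_zero]
  · intro f f' h
    have := congrArg Subtype.val h
    exact Subtype.ext this
  · intro (t : ι → k)
    refine ⟨⟨fun a b => if h : ∃ i, a = u i ∧ b = v i then t h.choose else 0, ?_⟩, ?_⟩
    · intro a b hab
      exact dif_neg fun h => hab ((hS _ _).2 (Or.inr h))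
    · funext i
      have h : ∃ i', u i = u i' ∧ v i = v i' := ⟨i, rfl, rfl⟩
      change (if h : ∃ i', u i = u i' ∧ v i = v i' then t h.choose else 0) = t i
      rw [dif_pos h, ← huv i _ h.choose_spec.1 h.choose_spec.2]
  · intro f
    constructor
    · intro hf
      refine ⟨⟨f.1, fun a b hab => ?_⟩, rfl⟩
      by_cases h : ∃ i, a = u i ∧ b = v i
      · obtain ⟨i, rfl, rfl⟩ := h
        exact congrFun hf i
      · exact f.2 _ _ (fun h' => by rcases (hS _ _).1 h' with h' | h' <;> contradiction)
    · rintro ⟨f, rfl⟩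
      funext i
      exact f.2 _ _ (h0 i)

def Td (p d : ℕ) (hd : d < p) : Dn p where
  S a b := a + b ≤ d
  dx a b h := by omega
  dy a b h := by omega
  bx a b h := by omega
  by' a b h := by omega

def Sq (p : ℕ) : Dn p where
  S a b := a < p ∧ b < p
  dx a b h := by omega
  dy a b h := by omega
  bx a b h := by omega
  by' a b h := by omega

def Kq (p : ℕ) : Dn p where
  S a b := a < p ∧ b < p ∧ a + b + 2 < p + p
  dx a b h := by omega
  dy a b h := by omega
  bx a b h := by omega
  by' a b h := by omega

def Uq (p : ℕ) : Dn p where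
  S a b := a = 0 ∧ b < p
  dx a b h := by omega
  dy a b h := by omega
  bx a b h := by omega
  by' a b h := by omega

lemma ses_K : ∃ j π, SES (mon k (Kq p)) (mon k (Sq p)) (triv p k k) j π := by
  have hp : p.Prime := Fact.out
  have := hp.two_le
  obtain ⟨j, π, h⟩ := ses_top (k := k) (Sq p) (Kq p) (ι := Unit) (fun _ => p - 1) (fun _ => p - 1)
    (fun _ _ _ _ => rfl) (fun a b => by
      simp only [Sq, Kq, exists_const]; omega)
    (fun _ => by simp only [Kq]; omega) (fun _ => by simp only [Sq]; omega)
    (fun _ => by simp only [Sq]; omega)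
  exact ⟨j, _, h.congr (Q' := triv p k k) (LinearEquiv.funUnique Unit k k) ⟨rfl, rfl⟩⟩

lemma ses_lead (h1 : p - 1 < p) (h2 : p - 2 < p) :
    ∃ j π, SES (mon k (Td p (p-2) h2)) (mon k (Td p (p-1) h1)) (triv p k (Fin p → k)) j π := by
  have hp : p.Prime := Fact.out
  have := hp.two_le
  refine ses_top _ _ (fun i => i.1) (fun i => p - 1 - i.1) (fun i i' h _ => Fin.ext h)
    (fun a b => ?_) (fun i => ?_) (fun i => ?_) (fun i => ?_)
  · simp only [Td]
    constructor
    · intro h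
      by_cases h' : a + b ≤ p - 2
      · exact Or.inl h'
      · exact Or.inr ⟨⟨a, by omega⟩, rfl, by simp only; omega⟩
    · rintro (h | ⟨i, rfl, rfl⟩)
      · omega
      · omega
  all_goals simp only [Td]; omega

lemma ses_U (h1 : p - 1 < p) (h2 : p - 2 < p) :
    ∃ j π, SES (mon k (Uq p)) (mon k (Td p (p-1) h1)) (mon k (Td p (p-2) h2)) j π := by
  have hp : p.Prime := Fact.out
  have := hp.two_le
  refine ⟨mmap _ _ LinearMap.id (fun f hf a b h => hf a b fun h' => h (by simp only [Td, Uq] at *; omega)),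
    mmap _ _ shx (fun f hf a b h => hf (a+1) b fun h' => h (by simp only [Td] at *; omega)),
    mmap_hom _ _ _ _ (fun _ => rfl) (fun _ => rfl), mmap_hom _ _ _ _ (fun _ => rfl) (fun _ => rfl), ?_, ?_, ?_⟩
  · intro f f' h
    have := congrArg Subtype.val h
    exact Subtype.ext this
  · intro f
    refine ⟨⟨fun a b => match a with | 0 => 0 | a + 1 => f.1 a b, fun a b hab => ?_⟩, rfl⟩
    rcases a with _ | a
    · rfl
    · refine f.2 _ _ (fun h => hab ?_)
      simp only [Td] at *; omega
  · intro f
    constructor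
    · intro hf
      have h0 : shx f.1 = 0 := congrArg Subtype.val hf
      refine ⟨⟨f.1, fun a b hab => ?_⟩, rfl⟩
      rcases a with _ | a
      · refine f.2 _ _ (fun h => hab ?_)
        have h' : 0 + b ≤ p - 1 := h
        exact ⟨rfl, by omega⟩
      · exact congrFun (congrFun h0 a) b
    · rintro ⟨f, rfl⟩
      refine Subtype.ext ?_
      funext a b
      refine f.2 _ _ ?_
      rintro ⟨h, _⟩
      exact Nat.succ_ne_zero _ h

lemma YEx_U : YEx (mon k (Uq p)) := by
  have hp : 0 < p := (Fact.out : p.Prime).pos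
  intro b v hv
  suffices h : ∃ w, v = alt p (mon k (Uq p)).y b w ∧ True by
    obtain ⟨w, hw, _⟩ := h; exact ⟨w, hw⟩
  refine alt_ex (p := p) (mon k (Uq p)).y (R := fun _ => True) (R' := fun _ => True)
    ?_ ?_ b v trivial hv
  · intro (f : Fn k (Uq p).S) _ hf
    rw [mon_y] at *
    refine ⟨⟨fun a b => if b = p - 1 then f.1 a 0 else 0, ?_⟩, ?_, trivial⟩
    · intro a b hab
      simp only
      split_ifs with h
      · exact f.2 _ _ (fun h => hab (by simp only [Uq] at *; omega))
      · rfl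
    · refine Subtype.ext (funext fun a => funext fun b => ?_)
      change _ = ((my k (Uq p) ^ (p-1)) _).1 a b
      rw [my_pow]
      rcases b with _ | b
      · simp
      · refine (congrFun (congrFun (congrArg Subtype.val hf) a) b).trans ?_
        exact (if_neg (by omega)).symm
  · intro (f : Fn k (Uq p).S) _ hf
    rw [mon_y] at *
    refine ⟨⟨fun a b => match b with | 0 => 0 | b + 1 => f.1 a b, ?_⟩, rfl, trivial⟩
    intro a b hab
    rcases b with _ | b
    · rfl
    · simp only
      by_cases h : a = 0 ∧ b = p - 1
      · obtain ⟨rfl, rfl⟩ := h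
        have := congrFun (congrFun (congrArg Subtype.val hf) 0) 0
        change ((my k (Uq p) ^ (p-1)) f).1 0 0 = 0 at this
        rw [my_pow] at this
        simpa using this
      · exact f.2 _ _ (fun h => hab (by simp only [Uq] at *; omega))

/-- `D` having bounded cohomology is contradictory -/
lemma D_unbounded (h1 : p - 1 < p) (C : ℕ) (h : ∀ m, Bd m (mon k (Td p (p-1) h1)) C) : False := by
  have hp : p.Prime := Fact.out
  obtain ⟨_, _, hU⟩ := ses_U (k := k) h1 (by omega : p - 2 < p)
  obtain ⟨_, _, hL⟩ := ses_lead (k := k) h1 (by omega : p - 2 < p)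
  set u := Module.finrank k (mon k (Uq p)).V
  have hR : ∀ m, Bd m (mon k (Td p (p-2) (by omega))) (C + u) := fun m =>
    Bd_quot hU (h m) (Bd_YEx YEx_U _)
  have ht := Bd_quot hL (h (C + (C + u))) (hR _)
  have := Bd_triv hp.two_le rfl rfl (fun _ : Fin p => (1 : k)) (by
    intro h0
    exact one_ne_zero (congrFun h0 ⟨0, hp.pos⟩)) ht
  omega

end mono
end SpNA


namespace SpNA
open scoped TensorProduct

section duals
variable {k : Type} [Field k] {p : ℕ}

@[reducible] noncomputable def dual' (N : RMod k p) : RMod k p where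
  V := Module.Dual k N.V
  g := N.g.dualMap
  h := N.h.dualMap
  gp := by
    have : ∀ n, N.g.dualMap ^ n = (N.g ^ n).dualMap := by
      intro n
      induction n with
      | zero => rfl
      | succ n ih => rw [pow_succ, ih, pow_succ']; rfl
    rw [this, N.gp]; rfl
  hp := by
    have : ∀ n, N.h.dualMap ^ n = (N.h ^ n).dualMap := by
      intro n
      induction n with
      | zero => rfl
      | succ n ih => rw [pow_succ, ih, pow_succ']; rfl
    rw [this, N.hp]; rfl
  comm := by
    change (N.h * N.g).dualMap = (N.g * N.h).dualMap
    rw [N.comm]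

end duals

section mono2
variable {k : Type} [Field k] {p : ℕ}

open Classical in
noncomputable def Eb (k : Type) [Field k] (S : Dn p) (a b : ℕ) : Fn k S.S :=
  ⟨fun a' b' => if S.S a b ∧ a' = a ∧ b' = b then 1 else 0, fun a' b' h => if_neg (by
    rintro ⟨h1, rfl, rfl⟩; exact h h1)⟩

lemma Eb_pos (S : Dn p) {a b : ℕ} (h : S.S a b) : (Eb k S a b).1 a b = 1 :=
  if_pos ⟨h, rfl, rfl⟩
lemma Eb_neg (S : Dn p) {a b a' b' : ℕ} (h : ¬ (a' = a ∧ b' = b)) : (Eb k S a b).1 a' b' = 0 :=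
  if_neg (fun h' => h h'.2)
lemma Eb_zero (S : Dn p) {a b : ℕ} (h : ¬ S.S a b) : Eb k S a b = 0 :=
  Subtype.ext (funext fun _ => funext fun _ => if_neg (fun h' => h h'.1))

lemma Eb_decomp (S : Dn p) (f : Fn k S.S) :
    f = ∑ a ∈ Finset.range p, ∑ b ∈ Finset.range p, f.1 a b • Eb k S a b := by
  refine Subtype.ext (funext fun a => funext fun b => ?_)
  have : ∀ (g : ℕ → ℕ → Fn k S.S), (∑ a ∈ Finset.range p, ∑ b ∈ Finset.range p, g a b).1 a b =
      ∑ a' ∈ Finset.range p, ∑ b' ∈ Finset.range p, (g a' b').1 a b := by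
    intro g
    simp [Finset.sum_apply]
  rw [this]
  by_cases h : S.S a b
  · rw [Finset.sum_eq_single a, Finset.sum_eq_single b]
    · change _ = f.1 a b * (Eb k S a b).1 a b
      rw [Eb_pos _ h, mul_one]
    · intro b' _ hb
      change f.1 a b' * (Eb k S a b').1 a b = 0
      rw [Eb_neg _ (by tauto), mul_zero]
    · intro hb; exact absurd (Finset.mem_range.2 (S.by' _ _ h)) hb
    · intro a' _ hb
      refine Finset.sum_eq_zero fun b' _ => ?_
      change f.1 a' b' * (Eb k S a' b').1 a b = 0
      rw [Eb_neg _ (by tauto), mul_zero]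
    · intro hb; exact absurd (Finset.mem_range.2 (S.bx _ _ h)) hb
  · rw [f.2 _ _ h]
    symm
    refine Finset.sum_eq_zero fun a' _ => Finset.sum_eq_zero fun b' _ => ?_
    change f.1 a' b' * (Eb k S a' b').1 a b = 0
    rw [(Eb k S a' b').2 _ _ h, mul_zero]

lemma mx_Eb (S : Dn p) (a b : ℕ) (h : S.S (a+1) b) : mx k S (Eb k S (a+1) b) = Eb k S a b := by
  refine Subtype.ext (funext fun a' => funext fun b' => ?_)
  rw [mx_apply]
  by_cases h1 : a' = a ∧ b' = b
  · obtain ⟨rfl, rfl⟩ := h1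
    rw [Eb_pos _ h, Eb_pos _ (S.dx _ _ h)]
  · rw [Eb_neg _ h1, Eb_neg _ (by omega)]
lemma my_Eb (S : Dn p) (a b : ℕ) (h : S.S a (b+1)) : my k S (Eb k S a (b+1)) = Eb k S a b := by
  refine Subtype.ext (funext fun a' => funext fun b' => ?_)
  rw [my_apply]
  by_cases h1 : a' = a ∧ b' = b
  · obtain ⟨rfl, rfl⟩ := h1
    rw [Eb_pos _ h, Eb_pos _ (S.dy _ _ h)]
  · rw [Eb_neg _ h1, Eb_neg _ (by omega)]

/-- alternating sum functional -/
noncomputable def lam (p : ℕ) : Fn k (Sq p).S →ₗ[k] k where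
  toFun f := ∑ a ∈ Finset.range p, ∑ b ∈ Finset.range p, (-1)^(a+b) * f.1 a b
  map_add' f f' := by
    simp only [← Finset.sum_add_distrib]
    refine Finset.sum_congr rfl fun a _ => Finset.sum_congr rfl fun b _ => ?_
    exact mul_add _ _ _
  map_smul' c f := by
    simp only [smul_eq_mul, Finset.mul_sum, RingHom.id_apply]
    refine Finset.sum_congr rfl fun a _ => Finset.sum_congr rfl fun b _ => ?_
    exact mul_left_comm _ _ _

lemma tele (f : ℕ → k) (n : ℕ) : ∑ a ∈ Finset.range n, (-1)^a * (f a + f (a+1)) = f 0 - (-1)^n * f n := by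
  induction n with
  | zero => simp
  | succ n ih => rw [Finset.sum_range_succ, ih]; ring

variable [Fact p.Prime] [CharP k p]

lemma lam_g (f : Fn k (Sq p).S) (hf : ∀ b, f.1 0 b = 0) : lam p ((mon k (Sq p)).g f) = 0 := by
  change ∑ a ∈ Finset.range p, ∑ b ∈ Finset.range p, (-1)^(a+b) * (f.1 a b + f.1 (a+1) b) = 0
  rw [Finset.sum_comm]
  refine Finset.sum_eq_zero fun b _ => ?_
  have := tele (fun a => (-1)^b * f.1 a b) p
  rw [hf, f.2 p b (by simp [Sq])] at this
  simp only [mul_zero, sub_zero] at this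
  rw [← this]
  refine Finset.sum_congr rfl fun a _ => by ring

lemma lam_h (f : Fn k (Sq p).S) (hf : ∀ a, f.1 a 0 = 0) : lam p ((mon k (Sq p)).h f) = 0 := by
  change ∑ a ∈ Finset.range p, ∑ b ∈ Finset.range p, (-1)^(a+b) * (f.1 a b + f.1 a (b+1)) = 0
  refine Finset.sum_eq_zero fun a _ => ?_
  have := tele (fun b => (-1)^a * f.1 a b) p
  rw [hf, f.2 a p (by simp [Sq])] at this
  simp only [mul_zero, sub_zero] at this
  rw [← this]
  refine Finset.sum_congr rfl fun a _ => by ring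

lemma g_supp (S : Dn p) (n t : ℕ) (f : Fn k S.S) (hf : ∀ a b, a < t → f.1 a b = 0) :
    ∀ a b, a + n < t → (show Fn k S.S from ((mon k S).g ^ n) f).1 a b = 0 := by
  induction n with
  | zero => exact fun a b h => hf a b h
  | succ n ih =>
    intro a b h
    rw [pow_succ']
    refine (mon_g S (((mon k S).g ^ n) f) a b).trans ?_
    have e1 := ih a b (by omega)
    have e2 := ih (a+1) b (by omega)
    simp only at e1 e2
    rw [e1, e2, add_zero]
lemma h_supp (S : Dn p) (n t : ℕ) (f : Fn k S.S) (hf : ∀ a b, b < t → f.1 a b = 0) :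
    ∀ a b, b + n < t → (show Fn k S.S from ((mon k S).h ^ n) f).1 a b = 0 := by
  induction n with
  | zero => exact fun a b h => hf a b h
  | succ n ih =>
    intro a b h
    rw [pow_succ']
    refine (mon_h S (((mon k S).h ^ n) f) a b).trans ?_
    have e1 := ih a b (by omega)
    have e2 := ih a (b+1) (by omega)
    simp only at e1 e2
    rw [e1, e2, add_zero]

lemma lam_gh (n m : ℕ) (hn : n < p) (hm : m < p) (h : ¬ (n = 0 ∧ m = 0)) :
    lam p (((mon k (Sq p)).g ^ n) (((mon k (Sq p)).h ^ m) (Eb k (Sq p) (p-1) (p-1)))) = 0 := by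
  have hc : Commute ((mon k (Sq p)).g ^ n) ((mon k (Sq p)).h ^ m) :=
    (mon k (Sq p)).cm.pow_pow _ _
  rcases n with _ | n
  · rcases m with _ | m
    · omega
    · rw [pow_zero, Module.End.one_apply, pow_succ', Module.End.mul_apply]
      refine lam_h _ fun a => ?_
      exact h_supp (Sq p) m (p-1) (Eb k (Sq p) (p-1) (p-1)) (fun a b h => Eb_neg _ (by omega)) a 0 (by omega)
  · have := LinearMap.congr_fun hc (Eb k (Sq p) (p-1) (p-1))
    simp only [Module.End.mul_apply] at this
    have h2 := LinearMap.congr_fun ((mon k (Sq p)).cm.pow_right m)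
      (((mon k (Sq p)).g ^ n) (Eb k (Sq p) (p-1) (p-1)))
    simp only [Module.End.mul_apply] at h2
    rw [this, pow_succ', Module.End.mul_apply, ← h2]
    refine lam_g _ fun b => ?_
    have hg := g_supp (k := k) (Sq p) n (p-1) (Eb k (Sq p) (p-1) (p-1)) (fun a b h => Eb_neg _ (by omega))
    set w : Fn k (Sq p).S := ((mon k (Sq p)).g ^ n) (Eb k (Sq p) (p-1) (p-1))
    have : ∀ m, ∀ b, (show Fn k (Sq p).S from ((mon k (Sq p)).h ^ m) w).1 0 b = 0 := by
      intro m
      induction m with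
      | zero => exact fun b => hg 0 b (by omega)
      | succ m ih =>
        intro b
        rw [pow_succ']
        refine (mon_h (Sq p) (((mon k (Sq p)).h ^ m) w) 0 b).trans ?_
        have e1 := ih b
        have e2 := ih (b+1)
        simp only at e1 e2
        rw [e1, e2, add_zero]
    exact this m b

lemma inv_pow_eq (hp : 0 < p) {V : Type} [AddCommGroup V] [Module k V] (A : Module.End k V)
    (hA : A ^ p = 1) (i : ℕ) (hi : i ≤ p) : (A ^ (p-1)) ^ i = A ^ (p - i) := by
  have h1 := inv_pow_pow hp A hA i
  have h2 : A ^ (p - i) * A ^ i = 1 := by rw [← pow_add, Nat.sub_add_cancel hi, hA]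
  calc _ = (A ^ (p - i) * A ^ i) * (A ^ (p-1)) ^ i := by rw [h2, one_mul]
    _ = _ := by rw [mul_assoc, h1, mul_one]

lemma Proj_F : Proj (mon k (Sq p)) := by
  have hp : 0 < p := (Fact.out : p.Prime).pos
  set v : (mon k (Sq p)).V := Eb k (Sq p) (p-1) (p-1) with hv
  let θ : (mon k (Sq p)).V →ₗ[k] (mon k (Sq p)).V := (lam p).smulRight v
  have hθ : ∀ w, θ w = lam p w • v := fun w => rfl
  refine ⟨θ, ?_⟩
  have h1 : Tr (mon k (Sq p)) (mon k (Sq p)) θ v = v := by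
    rw [Tr, CS_apply]
    have h0 : ∀ i, ∀ j, i < p → j < p → ¬ (i = 0 ∧ j = 0) →
      lam p ((((mon k (Sq p)).h ^ (p-1)) ^ j) ((((mon k (Sq p)).g ^ (p-1)) ^ i) v)) = 0 := by
      intro i j hi hj hij
      have hc : Commute (((mon k (Sq p)).g ^ (p-1))^i) (((mon k (Sq p)).h ^ (p-1))^j) :=
        ((mon k (Sq p)).cm.pow_pow _ _).pow_pow _ _
      have := LinearMap.congr_fun hc v
      simp only [Module.End.mul_apply] at this
      rw [← this]
      have hh : ∃ n, n < p ∧ (n = 0 → i = 0) ∧ ((mon k (Sq p)).g ^ (p-1)) ^ i = (mon k (Sq p)).g ^ n := by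
        by_cases h : i = 0
        · exact ⟨0, hp, fun _ => h, by rw [h]; rfl⟩
        · exact ⟨p - i, by omega, by omega, inv_pow_eq hp _ (mon k (Sq p)).gp _ hi.le⟩
      have hh' : ∃ n, n < p ∧ (n = 0 → j = 0) ∧ ((mon k (Sq p)).h ^ (p-1)) ^ j = (mon k (Sq p)).h ^ n := by
        by_cases h : j = 0
        · exact ⟨0, hp, fun _ => h, by rw [h]; rfl⟩
        · exact ⟨p - j, by omega, by omega, inv_pow_eq hp _ (mon k (Sq p)).hp _ hj.le⟩
      obtain ⟨n, hn, hn0, e1⟩ := hh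
      obtain ⟨m, hm, hm0, e2⟩ := hh'
      rw [e1, e2]
      exact lam_gh n m hn hm (by tauto)
    rw [Finset.sum_eq_single 0, CS_apply, Finset.sum_eq_single 0]
    · simp only [pow_zero, Module.End.one_apply]
      rw [hθ]
      have : lam p (k := k) v = 1 := by
        change ∑ a ∈ Finset.range p, ∑ b ∈ Finset.range p, (-1)^(a+b) * (Eb k (Sq p) (p-1) (p-1)).1 a b = 1
        rw [Finset.sum_eq_single (p-1), Finset.sum_eq_single (p-1)]
        · rw [Eb_pos _ (by simp [Sq]; omega), mul_one, ← two_mul]; simp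
        · intro b _ h; rw [Eb_neg _ (by tauto), mul_zero]
        · intro h; exact absurd (Finset.mem_range.2 (by omega)) h
        · intro a _ h
          exact Finset.sum_eq_zero fun b _ => by rw [Eb_neg _ (by tauto), mul_zero]
        · intro h; exact absurd (Finset.mem_range.2 (by omega)) h
      rw [this, one_smul]
    · intro j hj hj0
      rw [hθ, h0 0 j hp (Finset.mem_range.1 hj) (by tauto), zero_smul, map_zero]
    · intro h; exact absurd (Finset.mem_range.2 (by omega)) h
    · intro i hi hi0
      rw [CS_apply, Finset.sum_eq_zero, map_zero]
      intro j hj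
      rw [hθ, h0 i j (Finset.mem_range.1 hi) (Finset.mem_range.1 hj) (by tauto), zero_smul, map_zero]
    · intro h; exact absurd (Finset.mem_range.2 (by omega)) h
  obtain ⟨hg, hh⟩ := Tr_isHom hp θ
  set T := Tr (mon k (Sq p)) (mon k (Sq p)) θ
  have hx : ∀ w, T w = w → T (mx k (Sq p) w) = mx k (Sq p) w := by
    intro w hw
    have := LinearMap.congr_fun hg w
    simp only [LinearMap.comp_apply] at this
    rw [hw] at this
    change T (w + mx k (Sq p) w) = w + mx k (Sq p) w at this
    rw [map_add, hw] at this
    exact add_left_cancel this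
  have hy : ∀ w, T w = w → T (my k (Sq p) w) = my k (Sq p) w := by
    intro w hw
    have := LinearMap.congr_fun hh w
    simp only [LinearMap.comp_apply] at this
    rw [hw] at this
    change T (w + my k (Sq p) w) = w + my k (Sq p) w at this
    rw [map_add, hw] at this
    exact add_left_cancel this
  have hA : ∀ i, i < p → T (Eb k (Sq p) (p-1-i) (p-1)) = Eb k (Sq p) (p-1-i) (p-1) := by
    intro i
    induction i with
    | zero => exact fun _ => h1
    | succ i ih =>
      intro hi
      have := hx _ (ih (by omega))
      have e : p - 1 - i = (p-1-(i+1)) + 1 := by omega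
      rw [e, mx_Eb _ _ _ (by simp [Sq]; omega)] at this
      exact this
  have hB : ∀ i j, i < p → j < p → T (Eb k (Sq p) (p-1-i) (p-1-j)) = Eb k (Sq p) (p-1-i) (p-1-j) := by
    intro i j hi
    induction j with
    | zero => exact fun _ => hA i hi
    | succ j ih =>
      intro hj
      have := hy _ (ih (by omega))
      have e : p - 1 - j = (p-1-(j+1)) + 1 := by omega
      rw [e, my_Eb _ _ _ (by simp [Sq]; omega)] at this
      exact this
  refine LinearMap.ext fun f => ?_
  change T f = f
  have hd := Eb_decomp (Sq p) f
  have : T (∑ a ∈ Finset.range p, ∑ b ∈ Finset.range p, (show Fn k (Sq p).S from f).1 a b • Eb k (Sq p) a b)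
      = ∑ a ∈ Finset.range p, ∑ b ∈ Finset.range p, (show Fn k (Sq p).S from f).1 a b • Eb k (Sq p) a b := by
    rw [map_sum]
    refine Finset.sum_congr rfl fun a ha => ?_
    rw [map_sum]
    refine Finset.sum_congr rfl fun b hb => ?_
    rw [map_smul]
    have := hB (p-1-a) (p-1-b) (by omega) (by omega)
    rw [Finset.mem_range] at ha hb
    rw [Nat.sub_sub_self (by omega), Nat.sub_sub_self (by omega)] at this
    rw [this]
  rw [← hd] at this
  exact this

end mono2
end SpNA


namespace SpNA
open scoped TensorProduct

section mono3
variable {k : Type} [Field k] {p : ℕ}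

lemma sum_shift (hp : 0 < p) (u v : ℕ → k) (hu : u p = 0) (hv : v p = 0) :
    ∑ a ∈ Finset.range p, u (p-1-a+1) * v a = ∑ a ∈ Finset.range p, u (p-1-a) * v (a+1) := by
  obtain ⟨r, rfl⟩ : ∃ r, p = r + 1 := ⟨p-1, by omega⟩
  rw [Finset.sum_range_succ', Finset.sum_range_succ]
  simp only [Nat.add_sub_cancel, Nat.sub_zero, hu, hv, zero_mul, mul_zero, add_zero]
  refine Finset.sum_congr rfl fun a ha => ?_
  rw [Finset.mem_range] at ha
  congr 2; omega

noncomputable def pairing (p : ℕ) (S T : ℕ → ℕ → Prop) : Fn k S →ₗ[k] Fn k T →ₗ[k] k :=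
  LinearMap.mk₂ k (fun f q => ∑ a ∈ Finset.range p, ∑ b ∈ Finset.range p, f.1 (p-1-a) (p-1-b) * q.1 a b)
    (fun f f' q => by
      simp only [← Finset.sum_add_distrib]
      exact Finset.sum_congr rfl fun a _ => Finset.sum_congr rfl fun b _ => add_mul _ _ _)
    (fun c f q => by
      simp only [smul_eq_mul, Finset.mul_sum]
      exact Finset.sum_congr rfl fun a _ => Finset.sum_congr rfl fun b _ => mul_assoc _ _ _)
    (fun f q q' => by
      simp only [← Finset.sum_add_distrib]
      exact Finset.sum_congr rfl fun a _ => Finset.sum_congr rfl fun b _ => mul_add _ _ _)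
    (fun c f q => by
      simp only [smul_eq_mul, Finset.mul_sum]
      exact Finset.sum_congr rfl fun a _ => Finset.sum_congr rfl fun b _ => mul_left_comm _ _ _)

lemma pairing_apply (S T : ℕ → ℕ → Prop) (f : Fn k S) (q : Fn k T) : pairing p S T f q =
  ∑ a ∈ Finset.range p, ∑ b ∈ Finset.range p, f.1 (p-1-a) (p-1-b) * q.1 a b := rfl

lemma pairing_Eb (S : ℕ → ℕ → Prop) (T : Dn p) (f : Fn k S) (a b : ℕ) (h : T.S a b) :
    pairing p S T.S f (Eb k T a b) = f.1 (p-1-a) (p-1-b) := by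
  rw [pairing_apply, Finset.sum_eq_single a, Finset.sum_eq_single b]
  · rw [Eb_pos _ h, mul_one]
  · intro b' _ hb; rw [Eb_neg _ (by tauto), mul_zero]
  · intro hb; exact absurd (Finset.mem_range.2 (T.by' _ _ h)) hb
  · intro a' _ hb
    exact Finset.sum_eq_zero fun b' _ => by rw [Eb_neg _ (by tauto), mul_zero]
  · intro hb; exact absurd (Finset.mem_range.2 (T.bx _ _ h)) hb

variable [Fact p.Prime] [CharP k p]

lemma ses_R (h1 : p - 1 < p) (h2 : p - 2 < p) :
    ∃ j π, SES (mon k (Td p (p-1) h1)) (mon k (Sq p)) (dual' (mon k (Td p (p-2) h2))) j π := by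
  have hp : p.Prime := Fact.out
  have hp2 := hp.two_le
  have hT : ∀ a b, ¬ (a < p ∧ b < p) → ¬ (Td p (p-2) h2).S a b := fun a b h h' => by
    simp only [Td] at h'; omega
  refine ⟨mmap _ _ LinearMap.id (fun f hf a b h => hf a b fun h' => h (by simp only [Td, Sq] at *; omega)),
    pairing p (Sq p).S (Td p (p-2) h2).S,
    mmap_hom _ _ _ _ (fun _ => rfl) (fun _ => rfl), ⟨?_, ?_⟩, ?_, ?_, ?_⟩
  · refine LinearMap.ext fun f => LinearMap.ext fun q => ?_
    change pairing p (Sq p).S (Td p (p-2) h2).S (f + mx k _ f) q = pairing p (Sq p).S (Td p (p-2) h2).S f (q + mx k _ q)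
    rw [map_add, map_add, LinearMap.add_apply, pairing_apply _ _ (mx k _ f), pairing_apply _ _ _ (mx k _ q)]
    simp only [mx_apply]
    congr 1
    refine Finset.sum_comm.trans (Eq.trans ?_ Finset.sum_comm)
    refine Finset.sum_congr rfl fun b _ => ?_
    exact sum_shift hp.pos (fun a => f.1 a (p-1-b)) (fun a => q.1 a b) (f.2 _ _ (by simp [Sq]))
      (q.2 _ _ (hT _ _ (by omega)))
  · refine LinearMap.ext fun f => LinearMap.ext fun q => ?_
    change pairing p (Sq p).S (Td p (p-2) h2).S (f + my k _ f) q = pairing p (Sq p).S (Td p (p-2) h2).S f (q + my k _ q)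
    rw [map_add, map_add, LinearMap.add_apply, pairing_apply _ _ (my k _ f), pairing_apply _ _ _ (my k _ q)]
    simp only [my_apply]
    congr 1
    refine Finset.sum_congr rfl fun a _ => ?_
    exact sum_shift hp.pos (fun b => f.1 (p-1-a) b) (fun b => q.1 a b) (f.2 _ _ (by simp [Sq]))
      (q.2 _ _ (hT _ _ (by omega)))
  · intro f f' h
    have := congrArg Subtype.val h
    exact Subtype.ext this
  · intro (φ : Module.Dual k _)
    refine ⟨⟨fun a b => if a < p ∧ b < p then φ (Eb k (Td p (p-2) h2) (p-1-a) (p-1-b)) else 0,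
      fun a b h => if_neg h⟩, ?_⟩
    refine LinearMap.ext fun q => ?_
    rw [pairing_apply]
    conv_rhs => rw [Eb_decomp _ q, map_sum]
    refine Finset.sum_congr rfl fun a ha => ?_
    rw [map_sum]
    refine Finset.sum_congr rfl fun b hb => ?_
    rw [Finset.mem_range] at ha hb
    simp only [map_smul, smul_eq_mul]
    rw [if_pos (by omega), Nat.sub_sub_self (by omega), Nat.sub_sub_self (by omega), mul_comm]
  · intro f
    constructor
    · intro hf
      refine ⟨⟨f.1, fun a b hab => ?_⟩, rfl⟩
      by_cases h : a < p ∧ b < p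
      · have h3 := LinearMap.congr_fun hf (Eb k (Td p (p-2) h2) (p-1-a) (p-1-b))
        have h4 : ¬ a + b ≤ p - 1 := hab
        rw [pairing_Eb _ _ _ _ _ (by simp only [Td]; omega), Nat.sub_sub_self (by omega),
          Nat.sub_sub_self (by omega)] at h3
        exact h3
      · exact f.2 _ _ h
    · rintro ⟨f, rfl⟩
      refine LinearMap.ext fun q => ?_
      rw [pairing_apply]
      refine Finset.sum_eq_zero fun a ha => Finset.sum_eq_zero fun b hb => ?_
      rw [Finset.mem_range] at ha hb
      by_cases h : a + b ≤ p - 2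
      · have : f.1 (p-1-a) (p-1-b) = 0 := f.2 _ _ (by simp only [Td]; omega)
        exact mul_eq_zero_of_left this _
      · rw [q.2 _ _ h, mul_zero]

/-- locality of `D` -/
lemma local_D {d : ℕ} (hd : d < p) (c : (mon k (Td p d hd)).V →ₗ[k] (mon k (Td p d hd)).V)
    (hc : IsHom _ _ c) : ∃ χ : k, c (Eb k (Td p d hd) 0 0) = χ • Eb k (Td p d hd) 0 0 ∧
      (χ ≠ 0 → Function.Injective c) := by
  have hx : ∀ f, c (mx k _ f) = mx k _ (c f) := by
    intro f
    have := LinearMap.congr_fun hc.1 f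
    change c (f + mx k _ f) = c f + mx k _ (c f) at this
    rw [map_add] at this
    exact add_left_cancel this
  have hy : ∀ f, c (my k _ f) = my k _ (c f) := by
    intro f
    have := LinearMap.congr_fun hc.2 f
    change c (f + my k _ f) = c f + my k _ (c f) at this
    rw [map_add] at this
    exact add_left_cancel this
  have hx0 : mx k _ (Eb k (Td p d hd) 0 0) = 0 := Subtype.ext (funext fun a => funext fun b => Eb_neg _ (by omega))
  have hy0 : my k _ (Eb k (Td p d hd) 0 0) = 0 := Subtype.ext (funext fun a => funext fun b => Eb_neg _ (by omega))
  have h00 : (Td p d hd).S 0 0 := by simp [Td]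
  have hχ : c (Eb k (Td p d hd) 0 0) = (c (Eb k (Td p d hd) 0 0)).1 0 0 • Eb k (Td p d hd) 0 0 := by
    refine Subtype.ext (funext fun a => funext fun b => ?_)
    change _ = _ * (Eb k (Td p d hd) 0 0).1 a b
    rcases a with _ | a
    · rcases b with _ | b
      · rw [Eb_pos _ h00, mul_one]
      · rw [Eb_neg _ (by omega), mul_zero]
        have := hy (Eb k (Td p d hd) 0 0)
        rw [hy0, map_zero] at this
        exact (congrFun (congrFun (congrArg Subtype.val this) 0) b).symm
    · rw [Eb_neg _ (by omega), mul_zero]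
      have := hx (Eb k (Td p d hd) 0 0)
      rw [hx0, map_zero] at this
      exact (congrFun (congrFun (congrArg Subtype.val this) a) b).symm
  refine ⟨_, hχ, fun h0 => ?_⟩
  rw [← LinearMap.ker_eq_bot, LinearMap.ker_eq_bot']
  have key : ∀ n, ∀ f : Fn k (Td p d hd).S, (∀ a b, n ≤ a + b → f.1 a b = 0) → c f = 0 → f = 0 := by
    intro n
    induction n with
    | zero => exact fun f hf _ => Subtype.ext (funext fun a => funext fun b => hf a b (by omega))
    | succ n ih =>
      intro f hf hcf
      refine ih f (fun a b hab => ?_) hcf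
      by_cases hab' : n + 1 ≤ a + b
      · exact hf a b hab'
      have hxy : (mx k _ ^ a) ((my k _ ^ b) f) = f.1 a b • Eb k (Td p d hd) 0 0 := by
        refine Subtype.ext (funext fun a' => funext fun b' => ?_)
        rw [mx_pow, my_pow]
        change _ = _ * (Eb k (Td p d hd) 0 0).1 a' b'
        by_cases h : a' = 0 ∧ b' = 0
        · obtain ⟨rfl, rfl⟩ := h
          rw [Eb_pos _ h00, mul_one, zero_add, zero_add]
        · rw [Eb_neg _ h, mul_zero]
          exact hf _ _ (by omega)
      have hcx : ∀ a f, c f = 0 → c ((mx k _ ^ a) f) = 0 := by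
        intro a
        induction a with
        | zero => exact fun f h => h
        | succ a ih => intro f h; rw [pow_succ', Module.End.mul_apply, hx, ih f h, map_zero]
      have hcy : ∀ a f, c f = 0 → c ((my k _ ^ a) f) = 0 := by
        intro a
        induction a with
        | zero => exact fun f h => h
        | succ a ih => intro f h; rw [pow_succ', Module.End.mul_apply, hy, ih f h, map_zero]
      have h3 := hcx a _ (hcy b f hcf)
      rw [hxy, map_smul, hχ, smul_smul] at h3
      have h4 := congrFun (congrFun (congrArg Subtype.val h3) 0) 0
      change _ * (Eb k (Td p d hd) 0 0).1 0 0 = 0 at h4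
      rw [Eb_pos _ h00, mul_one] at h4
      exact (mul_eq_zero.1 h4).resolve_right h0
  intro f hf
  exact key (d+1) f (fun a b hab => f.2 _ _ (by simp only [Td]; omega)) hf

lemma Tr_D (h1 : p - 1 < p) (θ : (mon k (Td p (p-1) h1)).V →ₗ[k] (mon k (Td p (p-1) h1)).V) :
    Tr _ _ θ (Eb k (Td p (p-1) h1) 0 0) = 0 := by
  have hp : p.Prime := Fact.out
  have hp2 := hp.two_le
  have hx0 : (mon k (Td p (p-1) h1)).x (Eb k (Td p (p-1) h1) 0 0) = 0 := by
    rw [mon_x]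
    exact Subtype.ext (funext fun a => funext fun b => Eb_neg _ (by omega))
  have hy0 : (mon k (Td p (p-1) h1)).y (Eb k (Td p (p-1) h1) 0 0) = 0 := by
    rw [mon_y]
    exact Subtype.ext (funext fun a => funext fun b => Eb_neg _ (by omega))
  rw [Tr, CS_fixed _ _ _ (fixed_pow _ hx0 _), CS_fixed _ _ _ (fixed_pow _ hy0 _)]
  change ((mon k (Td p (p-1) h1)).x ^ (p-1)) (((mon k (Td p (p-1) h1)).y ^ (p-1)) _) = 0
  rw [mon_x, mon_y]
  refine Subtype.ext (funext fun a => funext fun b => ?_)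
  rw [mx_pow, my_pow]
  exact (θ (Eb k (Td p (p-1) h1) 0 0)).2 _ _ (by simp only [Td]; omega)

end mono3
end SpNA


namespace SpNA
open scoped TensorProduct

section retr
variable {k : Type} [Field k] {p : ℕ}

def phA (c : k) : (ℕ → ℕ → k) →ₗ[k] (ℕ → ℕ → k) where
  toFun f a b := f a b - c * ((a : k) * (f a b + f (a+1) b) + (b : k) * (f a b + f a (b+1)))
  map_add' f f' := by funext a b; simp only [Pi.add_apply]; ring
  map_smul' c f := by funext a b; simp only [Pi.smul_apply, smul_eq_mul, RingHom.id_apply]; ring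

def phS : (ℕ → ℕ → k) →ₗ[k] (ℕ → ℕ → k) where
  toFun f a b := (a : k) * (f (a-1) b + f a b)
  map_add' f f' := by funext a b; simp only [Pi.add_apply]; ring
  map_smul' c f := by funext a b; simp only [Pi.smul_apply, smul_eq_mul, RingHom.id_apply]; ring

def phT : (ℕ → ℕ → k) →ₗ[k] (ℕ → ℕ → k) where
  toFun f a b := (b : k) * (f a (b-1) + f a b)
  map_add' f f' := by funext a b; simp only [Pi.add_apply]; ring
  map_smul' c f := by funext a b; simp only [Pi.smul_apply, smul_eq_mul, RingHom.id_apply]; ring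

variable [Fact p.Prime] [CharP k p]

lemma Retr_Pd (d : ℕ) (hd : d + 1 < p) (hd' : d < p) (h1 : 1 < p) :
    Retr (mon k (Td p (d+1) hd)) (tens (mon k (Td p d hd')) (mon k (Td p 1 h1))) := by
  have hd0 : ((d : k) + 1) ≠ 0 := by
    intro h
    have h2 : ((d + 1 : ℕ) : k) = 0 := by push_cast; exact h
    rw [CharP.cast_eq_zero_iff k p] at h2
    exact absurd (Nat.le_of_dvd (by omega) h2) (by omega)
  set c : k := ((d : k) + 1)⁻¹ with hc
  have hc1 : c * ((d : k) + 1) = 1 := inv_mul_cancel₀ hd0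
  let A : Fn k (Td p (d+1) hd).S →ₗ[k] Fn k (Td p d hd').S := (phA c).restrict (by
    intro f hf a b hab
    have hab : ¬ (a + b ≤ d) := hab
    have e1 : f (a+1) b = 0 := hf _ _ (by simp only [Td]; omega)
    have e2 : f a (b+1) = 0 := hf _ _ (by simp only [Td]; omega)
    change f a b - c * ((a : k) * (f a b + f (a+1) b) + (b : k) * (f a b + f a (b+1))) = 0
    rw [e1, e2]
    by_cases h : a + b = d + 1
    · have : (a : k) + b = d + 1 := by exact_mod_cast congrArg (Nat.cast (R := k)) h
      have e3 : f a b - c * ((a : k) * (f a b + 0) + (b : k) * (f a b + 0)) = f a b - c * (a + b) * f a b := by ring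
      rw [e3, this, hc1]; ring
    · have : f a b = 0 := hf _ _ (by simp only [Td]; omega)
      rw [this]; ring)
  let B : Fn k (Td p (d+1) hd).S →ₗ[k] Fn k (Td p d hd').S := (c • shx).restrict (by
    intro f hf a b hab
    have hab : ¬ (a + b ≤ d) := hab
    have e1 : f (a+1) b = 0 := hf _ _ (by simp only [Td]; omega)
    change c * f (a+1) b = 0
    rw [e1, mul_zero])
  let C : Fn k (Td p (d+1) hd).S →ₗ[k] Fn k (Td p d hd').S := (c • shy).restrict (by
    intro f hf a b hab
    have hab : ¬ (a + b ≤ d) := hab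
    have e1 : f a (b+1) = 0 := hf _ _ (by simp only [Td]; omega)
    change c * f a (b+1) = 0
    rw [e1, mul_zero])
  let I : Fn k (Td p d hd').S →ₗ[k] Fn k (Td p (d+1) hd).S := LinearMap.id.restrict (by
    intro f hf a b hab
    exact hf _ _ (by simp only [Td] at *; omega))
  let Sx : Fn k (Td p d hd').S →ₗ[k] Fn k (Td p (d+1) hd).S := phS.restrict (by
    intro f hf a b hab
    have hab : ¬ (a + b ≤ d + 1) := hab
    have e1 : f (a-1) b = 0 := hf _ _ (by simp only [Td]; omega)
    have e2 : f a b = 0 := hf _ _ (by simp only [Td]; omega)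
    change (a : k) * (f (a-1) b + f a b) = 0
    rw [e1, e2]; ring)
  let Ty : Fn k (Td p d hd').S →ₗ[k] Fn k (Td p (d+1) hd).S := phT.restrict (by
    intro f hf a b hab
    have hab : ¬ (a + b ≤ d + 1) := hab
    have e1 : f a (b-1) = 0 := hf _ _ (by simp only [Td]; omega)
    have e2 : f a b = 0 := hf _ _ (by simp only [Td]; omega)
    change (b : k) * (f a (b-1) + f a b) = 0
    rw [e1, e2]; ring)
  have s00 : (Td p 1 h1).S 0 0 := by simp [Td]
  have s10 : (Td p 1 h1).S 1 0 := by simp [Td]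
  have s01 : (Td p 1 h1).S 0 1 := by simp [Td]
  let e00 : Fn k (Td p 1 h1).S := Eb k (Td p 1 h1) 0 0
  let e10 : Fn k (Td p 1 h1).S := Eb k (Td p 1 h1) 1 0
  let e01 : Fn k (Td p 1 h1).S := Eb k (Td p 1 h1) 0 1
  let tm : Fn k (Td p 1 h1).S → (Fn k (Td p d hd').S →ₗ[k] Fn k (Td p d hd').S ⊗[k] Fn k (Td p 1 h1).S) :=
    fun e => (TensorProduct.mk k _ _).flip e
  let δ : Fn k (Td p (d+1) hd).S →ₗ[k] Fn k (Td p d hd').S ⊗[k] Fn k (Td p 1 h1).S :=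
    tm e00 ∘ₗ A + tm e10 ∘ₗ B + tm e01 ∘ₗ C
  have hδ : ∀ f, δ f = A f ⊗ₜ e00 + B f ⊗ₜ e10 + C f ⊗ₜ e01 := fun f => rfl
  let bil : Fn k (Td p d hd').S →ₗ[k] Fn k (Td p 1 h1).S →ₗ[k] Fn k (Td p (d+1) hd).S :=
    LinearMap.mk₂ k (fun q l => l.1 0 0 • I q + l.1 1 0 • Sx q + l.1 0 1 • Ty q)
      (fun q q' l => by simp only [map_add, smul_add]; abel)
      (fun c q l => by simp only [map_smul, smul_add, smul_comm c])
      (fun q l l' => by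
        have e : ∀ a b, (l + l').1 a b = l.1 a b + l'.1 a b := fun _ _ => rfl
        simp only [e, add_smul]; abel)
      (fun c q l => by
        have e : ∀ a b, (c • l).1 a b = c * l.1 a b := fun _ _ => rfl
        simp only [e, mul_smul, smul_add])
  let μ : Fn k (Td p d hd').S ⊗[k] Fn k (Td p 1 h1).S →ₗ[k] Fn k (Td p (d+1) hd).S := TensorProduct.lift bil
  have hμ : ∀ q l, μ (q ⊗ₜ l) = l.1 0 0 • I q + l.1 1 0 • Sx q + l.1 0 1 • Ty q := fun q l => rfl
  -- action on e's
  have n1 : ∀ {a b a' b' : ℕ}, ¬ (a' = a ∧ b' = b) → (Eb k (Td p 1 h1) a b).1 a' b' = 0 := fun h => Eb_neg _ h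
  have gx00 : mx k (Td p 1 h1) e00 = 0 := Subtype.ext (funext fun a => funext fun b => Eb_neg _ (by omega))
  have gx01 : mx k (Td p 1 h1) e01 = 0 := Subtype.ext (funext fun a => funext fun b => Eb_neg _ (by omega))
  have gx10 : mx k (Td p 1 h1) e10 = e00 := mx_Eb _ 0 0 s10
  have gy00 : my k (Td p 1 h1) e00 = 0 := Subtype.ext (funext fun a => funext fun b => Eb_neg _ (by omega))
  have gy10 : my k (Td p 1 h1) e10 = 0 := Subtype.ext (funext fun a => funext fun b => Eb_neg _ (by omega))
  have gy01 : my k (Td p 1 h1) e01 = e00 := my_Eb _ 0 0 s01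
  refine ⟨δ, μ, ⟨?_, ?_⟩, ⟨?_, ?_⟩, ?_⟩
  · refine LinearMap.ext fun f => ?_
    change δ (f + mx k _ f) = TensorProduct.map (1 + mx k _) (1 + mx k _) (δ f)
    rw [hδ, hδ]
    simp only [map_add, TensorProduct.map_tmul, LinearMap.add_apply, Module.End.one_apply, gx00, gx01, gx10,
      add_zero]
    have a1 : A (mx k _ f) = mx k _ (A f) + (B f + mx k _ (B f)) := by
      refine Subtype.ext (funext fun a => funext fun b => ?_)
      change f.1 (a+1) b - c * ((a : k) * (f.1 (a+1) b + f.1 (a+1+1) b) + (b : k) * (f.1 (a+1) b + f.1 (a+1) (b+1)))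
        = (f.1 (a+1) b - c * (((a+1 : ℕ) : k) * (f.1 (a+1) b + f.1 (a+1+1) b) + (b : k) * (f.1 (a+1) b + f.1 (a+1) (b+1))))
          + (c * f.1 (a+1) b + c * f.1 (a+1+1) b)
      push_cast; ring
    have a2 : B (mx k _ f) = mx k _ (B f) := rfl
    have a3 : C (mx k _ f) = mx k _ (C f) := rfl
    rw [a1, a2, a3]
    simp only [TensorProduct.add_tmul, TensorProduct.tmul_add]
    abel
  · refine LinearMap.ext fun f => ?_
    change δ (f + my k _ f) = TensorProduct.map (1 + my k _) (1 + my k _) (δ f)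
    rw [hδ, hδ]
    simp only [map_add, TensorProduct.map_tmul, LinearMap.add_apply, Module.End.one_apply, gy00, gy01, gy10,
      add_zero]
    have a1 : A (my k _ f) = my k _ (A f) + (C f + my k _ (C f)) := by
      refine Subtype.ext (funext fun a => funext fun b => ?_)
      change f.1 a (b+1) - c * ((a : k) * (f.1 a (b+1) + f.1 (a+1) (b+1)) + (b : k) * (f.1 a (b+1) + f.1 a (b+1+1)))
        = (f.1 a (b+1) - c * ((a : k) * (f.1 a (b+1) + f.1 (a+1) (b+1)) + ((b+1 : ℕ) : k) * (f.1 a (b+1) + f.1 a (b+1+1))))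
          + (c * f.1 a (b+1) + c * f.1 a (b+1+1))
      push_cast; ring
    have a2 : B (my k _ f) = my k _ (B f) := rfl
    have a3 : C (my k _ f) = my k _ (C f) := rfl
    rw [a1, a2, a3]
    simp only [TensorProduct.add_tmul, TensorProduct.tmul_add]
    abel
  · refine TensorProduct.ext' fun q l => ?_
    change μ ((q + mx k _ q) ⊗ₜ (l + mx k _ l)) = μ (q ⊗ₜ l) + mx k _ (μ (q ⊗ₜ l))
    rw [hμ, hμ]
    refine Subtype.ext (funext fun a => funext fun b => ?_)
    have l20 : l.1 2 0 = 0 := l.2 _ _ (by simp [Td])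
    have l11 : l.1 1 1 = 0 := l.2 _ _ (by simp [Td])
    change (l.1 0 0 + l.1 1 0) * (q.1 a b + q.1 (a+1) b) + (l.1 1 0 + l.1 2 0) * ((a : k) * ((q.1 (a-1) b + q.1 (a-1+1) b) + (q.1 a b + q.1 (a+1) b)))
       + (l.1 0 1 + l.1 1 1) * ((b : k) * ((q.1 a (b-1) + q.1 (a+1) (b-1)) + (q.1 a b + q.1 (a+1) b)))
      = (l.1 0 0 * q.1 a b + l.1 1 0 * ((a : k) * (q.1 (a-1) b + q.1 a b)) + l.1 0 1 * ((b : k) * (q.1 a (b-1) + q.1 a b)))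
      + (l.1 0 0 * q.1 (a+1) b + l.1 1 0 * (((a+1 : ℕ) : k) * (q.1 a b + q.1 (a+1) b)) + l.1 0 1 * ((b : k) * (q.1 (a+1) (b-1) + q.1 (a+1) b)))
    rw [l20, l11]
    rcases a with _ | a
    · simp; ring
    · rw [Nat.add_sub_cancel]; push_cast; ring
  · refine TensorProduct.ext' fun q l => ?_
    change μ ((q + my k _ q) ⊗ₜ (l + my k _ l)) = μ (q ⊗ₜ l) + my k _ (μ (q ⊗ₜ l))
    rw [hμ, hμ]
    refine Subtype.ext (funext fun a => funext fun b => ?_)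
    have l02 : l.1 0 2 = 0 := l.2 _ _ (by simp [Td])
    have l11 : l.1 1 1 = 0 := l.2 _ _ (by simp [Td])
    change (l.1 0 0 + l.1 0 1) * (q.1 a b + q.1 a (b+1)) + (l.1 1 0 + l.1 1 1) * ((a : k) * ((q.1 (a-1) b + q.1 (a-1) (b+1)) + (q.1 a b + q.1 a (b+1))))
       + (l.1 0 1 + l.1 0 2) * ((b : k) * ((q.1 a (b-1) + q.1 a (b-1+1)) + (q.1 a b + q.1 a (b+1))))
      = (l.1 0 0 * q.1 a b + l.1 1 0 * ((a : k) * (q.1 (a-1) b + q.1 a b)) + l.1 0 1 * ((b : k) * (q.1 a (b-1) + q.1 a b)))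
      + (l.1 0 0 * q.1 a (b+1) + l.1 1 0 * ((a : k) * (q.1 (a-1) (b+1) + q.1 a (b+1))) + l.1 0 1 * (((b+1 : ℕ) : k) * (q.1 a b + q.1 a (b+1))))
    rw [l02, l11]
    rcases b with _ | b
    · simp; ring
    · rw [Nat.add_sub_cancel]; push_cast; ring
  · refine LinearMap.ext fun f => ?_
    change μ (δ f) = f
    rw [hδ, map_add, map_add, hμ, hμ, hμ]
    have z1 : e00.1 0 0 = 1 := Eb_pos _ s00
    have z2 : e00.1 1 0 = 0 := Eb_neg _ (by omega)
    have z3 : e00.1 0 1 = 0 := Eb_neg _ (by omega)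
    have z4 : e10.1 0 0 = 0 := Eb_neg _ (by omega)
    have z5 : e10.1 1 0 = 1 := Eb_pos _ s10
    have z6 : e10.1 0 1 = 0 := Eb_neg _ (by omega)
    have z7 : e01.1 0 0 = 0 := Eb_neg _ (by omega)
    have z8 : e01.1 1 0 = 0 := Eb_neg _ (by omega)
    have z9 : e01.1 0 1 = 1 := Eb_pos _ s01
    rw [z1, z2, z3, z4, z5, z6, z7, z8, z9]
    simp only [zero_smul, one_smul, add_zero, zero_add]
    refine Subtype.ext (funext fun a => funext fun b => ?_)
    change (f.1 a b - c * ((a : k) * (f.1 a b + f.1 (a+1) b) + (b : k) * (f.1 a b + f.1 a (b+1))))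
      + (a : k) * (c * f.1 (a-1+1) b + c * f.1 (a+1) b) + (b : k) * (c * f.1 a (b-1+1) + c * f.1 a (b+1)) = f.1 a b
    rcases a with _ | a <;> rcases b with _ | b <;> simp <;> ring

end retr
end SpNA


namespace SpNA
open scoped TensorProduct

section tensorstuff
variable {k : Type} [Field k] {p : ℕ} {X Y Z W : RMod k p}

lemma Retr.of_equiv (e : X.V ≃ₗ[k] Y.V) (he : IsHom X Y e.toLinearMap) : Retr X Y := by
  refine ⟨e.toLinearMap, e.symm.toLinearMap, he, ⟨?_, ?_⟩, by ext; simp⟩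
  · ext v
    have := LinearMap.congr_fun he.1 (e.symm v)
    simp only [LinearMap.comp_apply, LinearEquiv.coe_coe, LinearEquiv.apply_symm_apply] at this ⊢
    rw [← this, LinearEquiv.symm_apply_apply]
  · ext v
    have := LinearMap.congr_fun he.2 (e.symm v)
    simp only [LinearMap.comp_apply, LinearEquiv.coe_coe, LinearEquiv.apply_symm_apply] at this ⊢
    rw [← this, LinearEquiv.symm_apply_apply]

lemma Retr.of_equiv_symm (e : X.V ≃ₗ[k] Y.V) (he : IsHom X Y e.toLinearMap) : Retr Y X := by
  refine ⟨e.symm.toLinearMap, e.toLinearMap, ⟨?_, ?_⟩, he, by ext; simp⟩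
  · ext v
    have := LinearMap.congr_fun he.1 (e.symm v)
    simp only [LinearMap.comp_apply, LinearEquiv.coe_coe, LinearEquiv.apply_symm_apply] at this ⊢
    rw [← this, LinearEquiv.symm_apply_apply]
  · ext v
    have := LinearMap.congr_fun he.2 (e.symm v)
    simp only [LinearMap.comp_apply, LinearEquiv.coe_coe, LinearEquiv.apply_symm_apply] at this ⊢
    rw [← this, LinearEquiv.symm_apply_apply]

lemma retr_comm (X Y : RMod k p) : Retr (tens X Y) (tens Y X) := by
  refine Retr.of_equiv (TensorProduct.comm k X.V Y.V) ⟨?_, ?_⟩ <;>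
  exact TensorProduct.ext' fun a b => rfl

lemma retr_assoc (X Y Z : RMod k p) : Retr (tens (tens X Y) Z) (tens X (tens Y Z)) := by
  refine Retr.of_equiv (TensorProduct.assoc k X.V Y.V Z.V) ⟨?_, ?_⟩ <;>
  exact TensorProduct.ext_threefold fun a b c => rfl

lemma retr_assoc' (X Y Z : RMod k p) : Retr (tens X (tens Y Z)) (tens (tens X Y) Z) := by
  refine Retr.of_equiv (TensorProduct.assoc k X.V Y.V Z.V).symm ⟨?_, ?_⟩ <;>
  exact TensorProduct.ext (LinearMap.ext fun a => TensorProduct.ext' fun b c => rfl)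

lemma retr_unit (X Y : RMod k p) (e : X.V ≃ₗ[k] k) (hg : X.g = 1) (hh : X.h = 1) :
    Retr (tens Y X) Y := by
  refine Retr.of_equiv ((TensorProduct.congr (LinearEquiv.refl k Y.V) e).trans
    (TensorProduct.rid k Y.V)) ⟨?_, ?_⟩ <;> refine TensorProduct.ext' fun a b => ?_
  · change (TensorProduct.rid k Y.V) (Y.g a ⊗ₜ e (X.g b)) = Y.g ((TensorProduct.rid k Y.V) (a ⊗ₜ e b))
    simp [hg]
  · change (TensorProduct.rid k Y.V) (Y.h a ⊗ₜ e (X.h b)) = Y.h ((TensorProduct.rid k Y.V) (a ⊗ₜ e b))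
    simp [hh]

/-- exactness of tensoring -/
lemma ses_tens_right {S P Q : RMod k p} {j : S.V →ₗ[k] P.V} {π : P.V →ₗ[k] Q.V}
    (h : SES S P Q j π) (W : RMod k p) :
    SES (tens S W) (tens P W) (tens Q W) (TensorProduct.map j LinearMap.id)
      (TensorProduct.map π LinearMap.id) where
  hj := h.hj.tens IsHom.id
  hπ := h.hπ.tens IsHom.id
  inj := Module.Flat.rTensor_preserves_injective_linearMap (M := W.V) j h.inj
  surj := LinearMap.rTensor_surjective W.V h.surj
  ex := rTensor_exact W.V h.ex h.surj

lemma ses_tens_left {S P Q : RMod k p} {j : S.V →ₗ[k] P.V} {π : P.V →ₗ[k] Q.V}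
    (h : SES S P Q j π) (W : RMod k p) :
    SES (tens W S) (tens W P) (tens W Q) (TensorProduct.map LinearMap.id j)
      (TensorProduct.map LinearMap.id π) where
  hj := IsHom.id.tens h.hj
  hπ := IsHom.id.tens h.hπ
  inj := Module.Flat.lTensor_preserves_injective_linearMap (M := W.V) j h.inj
  surj := LinearMap.lTensor_surjective W.V h.surj
  ex := lTensor_exact W.V h.ex h.surj

/-- twisted duals -/
@[reducible] noncomputable def du (e : ℕ) (N : RMod k p) : RMod k p where
  V := Module.Dual k N.V
  g := (dual' N).g ^ e
  h := (dual' N).h ^ e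
  gp := by rw [← pow_mul, mul_comm, pow_mul, (dual' N).gp, one_pow]
  hp := by rw [← pow_mul, mul_comm, pow_mul, (dual' N).hp, one_pow]
  comm := (Commute.pow_pow (dual' N).comm _ _ : Commute _ _)

lemma dual_hom {f : X.V →ₗ[k] Y.V} (hf : IsHom X Y f) (e : ℕ) : IsHom (du e Y) (du e X) f.dualMap := by
  constructor
  · refine pow_intertwine (A := (dual' X).g) (B := (dual' Y).g) ?_ e
    exact congrArg LinearMap.dualMap hf.1.symm
  · refine pow_intertwine (A := (dual' X).h) (B := (dual' Y).h) ?_ e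
    exact congrArg LinearMap.dualMap hf.2.symm

lemma retr_du (h : Retr X Y) (e : ℕ) : Retr (du e X) (du e Y) := by
  obtain ⟨i, r, hi, hr, h⟩ := h
  exact ⟨r.dualMap, i.dualMap, dual_hom hr e, dual_hom hi e, congrArg LinearMap.dualMap h⟩

lemma dualMap_pow {V : Type} [AddCommGroup V] [Module k V] (f : Module.End k V) (n : ℕ) :
    (LinearMap.dualMap f : Module.End k (Module.Dual k V)) ^ n = (f ^ n).dualMap := by
  induction n with
  | zero => rfl
  | succ n ih => rw [pow_succ, ih, pow_succ']; rfl

lemma retr_du_tens (X Y : RMod k p) [FiniteDimensional k X.V] [FiniteDimensional k Y.V] (e : ℕ) :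
    Retr (du e (tens X Y)) (tens (du e X) (du e Y)) := by
  obtain ⟨E, hE⟩ : ∃ E : Module.Dual k X.V ⊗[k] Module.Dual k Y.V ≃ₗ[k] Module.Dual k (X.V ⊗[k] Y.V),
      ∀ a b x y, E (a ⊗ₜ b) (x ⊗ₜ y) = a x * b y :=
    ⟨TensorProduct.dualDistribEquiv k X.V Y.V, fun a b x y => by
      simp [TensorProduct.dualDistribEquiv, TensorProduct.dualDistribEquivOfBasis]⟩
  have key : ∀ (A : Module.End k X.V) (B : Module.End k Y.V),
      E.toLinearMap ∘ₗ (TensorProduct.map A.dualMap B.dualMap)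
       = (TensorProduct.map A B).dualMap ∘ₗ E.toLinearMap := by
    intro A B
    refine TensorProduct.ext' fun a b => TensorProduct.ext' fun x y => ?_
    change E (A.dualMap a ⊗ₜ B.dualMap b) (x ⊗ₜ y) = E (a ⊗ₜ b) (A x ⊗ₜ B y)
    rw [hE, hE]; rfl
  refine Retr.of_equiv_symm (X := tens (du e X) (du e Y)) (Y := du e (tens X Y)) E ⟨?_, ?_⟩
  · have := key (X.g ^ e) (Y.g ^ e)
    rw [← TensorProduct.map_pow, ← dualMap_pow, ← dualMap_pow, ← dualMap_pow] at this
    exact this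
  · have := key (X.h ^ e) (Y.h ^ e)
    rw [← TensorProduct.map_pow, ← dualMap_pow, ← dualMap_pow, ← dualMap_pow] at this
    exact this

/-- X is a retract of X* ⊗ X ⊗ X -/
lemma retr_coev (hp : 0 < p) (X : RMod k p) [FiniteDimensional k X.V] :
    Retr X (tens (tens (du (p-1) X) X) X) := by
  have key : ∀ (A B : Module.End k X.V) (x : Module.Dual k X.V ⊗[k] X.V),
      dualTensorHom k X.V X.V (TensorProduct.map B.dualMap A x) = A ∘ₗ dualTensorHom k X.V X.V x ∘ₗ B := by
    intro A B x
    induction x with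
    | zero => simp
    | add x y hx hy => simp only [map_add, hx, hy, LinearMap.add_comp, LinearMap.comp_add]
    | tmul f v => ext; simp [dualTensorHom_apply]
  have inv1 : ∀ A : Module.End k X.V, A ^ p = 1 → A ∘ₗ (A ^ (p-1)) = LinearMap.id := by
    intro A hA
    change A * A ^ (p-1) = 1
    rw [← pow_succ', Nat.sub_add_cancel hp, hA]
  have inv2 : ∀ A : Module.End k X.V, A ^ p = 1 → (A ^ (p-1)) ∘ₗ A = LinearMap.id := by
    intro A hA
    change A ^ (p-1) * A = 1
    rw [← pow_succ, Nat.sub_add_cancel hp, hA]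
  obtain ⟨c, hc⟩ : ∃ c, dualTensorHom k X.V X.V c = LinearMap.id :=
    ⟨(dualTensorHomEquiv k X.V X.V).symm LinearMap.id, by
      have := (dualTensorHomEquiv k X.V X.V).apply_symm_apply LinearMap.id
      simpa using this⟩
  have cinv : ∀ A : Module.End k X.V, A ^ p = 1 → TensorProduct.map (A ^ (p-1)).dualMap A c = c := by
    intro A hA
    apply (dualTensorHomEquiv k X.V X.V).injective
    have := key A (A ^ (p-1)) c
    rw [hc, LinearMap.id_comp, inv1 A hA, ← hc] at this
    simpa using this
  refine ⟨TensorProduct.mk k _ _ c, TensorProduct.lift (dualTensorHom k X.V X.V), ⟨?_, ?_⟩, ⟨?_, ?_⟩, ?_⟩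
  · ext v
    change c ⊗ₜ[k] (X.g v) = (TensorProduct.map ((LinearMap.dualMap X.g : Module.End k (Module.Dual k X.V)) ^ (p-1)) X.g c) ⊗ₜ (X.g v)
    rw [dualMap_pow, cinv _ X.gp]
  · ext v
    change c ⊗ₜ[k] (X.h v) = (TensorProduct.map ((LinearMap.dualMap X.h : Module.End k (Module.Dual k X.V)) ^ (p-1)) X.h c) ⊗ₜ (X.h v)
    rw [dualMap_pow, cinv _ X.hp]
  · refine TensorProduct.ext' fun x v => ?_
    change dualTensorHom k X.V X.V (TensorProduct.map ((LinearMap.dualMap X.g : Module.End k (Module.Dual k X.V)) ^ (p-1)) X.g x) (X.g v) = X.g (dualTensorHom k X.V X.V x v)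
    rw [dualMap_pow]
    refine (LinearMap.congr_fun (key X.g (X.g ^ (p-1)) x) (X.g v)).trans ?_
    have := LinearMap.congr_fun (inv2 _ X.gp) v
    simp only [LinearMap.comp_apply] at this ⊢
    rw [this]; rfl
  · refine TensorProduct.ext' fun x v => ?_
    change dualTensorHom k X.V X.V (TensorProduct.map ((LinearMap.dualMap X.h : Module.End k (Module.Dual k X.V)) ^ (p-1)) X.h x) (X.h v) = X.h (dualTensorHom k X.V X.V x v)
    rw [dualMap_pow]
    refine (LinearMap.congr_fun (key X.h (X.h ^ (p-1)) x) (X.h v)).trans ?_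
    have := LinearMap.congr_fun (inv2 _ X.hp) v
    simp only [LinearMap.comp_apply] at this ⊢
    rw [this]; rfl
  · ext v
    change dualTensorHom k X.V X.V c v = v
    rw [hc]; rfl

end tensorstuff
end SpNA


namespace SpNA
open scoped TensorProduct

section cls
variable {k : Type} [Field k] {p : ℕ} {X Y Z W : RMod k p}

noncomputable def TP (M : RMod k p) : ℕ → RMod k p
  | 0 => M
  | n + 1 => tens (TP M n) M

def InT (M Y : RMod k p) : Prop := ∀ n, ∃ n', Retr (tens (TP M n) Y) (TP M n')

variable {M : RMod k p}

lemma InT.self : InT M M := fun n => ⟨n + 1, Retr.refl _⟩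
lemma InT.retr (h : Retr X Y) (hY : InT M Y) : InT M X := fun n => by
  obtain ⟨n', h'⟩ := hY n
  exact ⟨n', ((Retr.refl _).tens h).trans h'⟩
lemma InT.mul (hX : InT M X) (hY : InT M Y) : InT M (tens X Y) := fun n => by
  obtain ⟨n', h'⟩ := hX n
  obtain ⟨n'', h''⟩ := hY n'
  exact ⟨n'', (retr_assoc' _ _ _).trans ((h'.tens (Retr.refl _)).trans h'')⟩
lemma InT.unit (e : X.V ≃ₗ[k] k) (hg : X.g = 1) (hh : X.h = 1) : InT M X := fun n =>
  ⟨n, retr_unit X _ e hg hh⟩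

variable [Fact p.Prime] [CharP k p]

lemma P0_unit (h : 0 < p) : Nonempty ((mon k (Td p 0 h)).V ≃ₗ[k] k) ∧ (mon k (Td p 0 h)).g = 1 ∧
    (mon k (Td p 0 h)).h = 1 := by
  refine ⟨⟨LinearEquiv.ofBijective
    { toFun := fun f => f.1 0 0, map_add' := fun _ _ => rfl, map_smul' := fun _ _ => rfl } ⟨?_, ?_⟩⟩, ?_, ?_⟩
  · intro f f' hf
    refine Subtype.ext (funext fun a => funext fun b => ?_)
    by_cases hab : a + b ≤ 0
    · obtain ⟨rfl, rfl⟩ : a = 0 ∧ b = 0 := by omega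
      exact hf
    · rw [f.2 a b hab, f'.2 a b hab]
  · intro c
    refine ⟨c • Eb k (Td p 0 h) 0 0, ?_⟩
    change c * (Eb k (Td p 0 h) 0 0).1 0 0 = c
    rw [Eb_pos _ (by simp [Td]), mul_one]
  · have : mx k (Td p 0 h) = 0 := by
      ext f : 1
      refine Subtype.ext (funext fun a => funext fun b => ?_)
      exact f.2 (a+1) b (by simp [Td])
    change 1 + mx k (Td p 0 h) = 1
    rw [this, add_zero]
  · have : my k (Td p 0 h) = 0 := by
      ext f : 1
      refine Subtype.ext (funext fun a => funext fun b => ?_)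
      exact f.2 a (b+1) (by simp [Td])
    change 1 + my k (Td p 0 h) = 1
    rw [this, add_zero]

lemma InT_P (h1 : 1 < p) (hP1 : InT M (mon k (Td p 1 h1))) (d : ℕ) (hd : d < p) :
    InT M (mon k (Td p d hd)) := by
  induction d with
  | zero =>
    obtain ⟨⟨e⟩, hg, hh⟩ := P0_unit (k := k) hd
    exact InT.unit e hg hh
  | succ d ih => exact InT.retr (Retr_Pd d hd (by omega) h1) ((ih (by omega)).mul hP1)

lemma InT_du (e : ℕ) (h1 : 1 < p) (hP1 : InT M (du e (mon k (Td p 1 h1)))) (d : ℕ) (hd : d < p) :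
    InT M (du e (mon k (Td p d hd))) := by
  induction d with
  | zero =>
    obtain ⟨⟨E⟩, hg, hh⟩ := P0_unit (k := k) hd
    refine InT.unit (X := du e (mon k (Td p 0 hd))) (E.symm.dualMap.trans (LinearMap.ringLmapEquivSelf k k k)) ?_ ?_
    · change (LinearMap.dualMap (mon k (Td p 0 hd)).g : Module.End k _) ^ e = 1
      rw [hg, dualMap_pow, one_pow]; rfl
    · change (LinearMap.dualMap (mon k (Td p 0 hd)).h : Module.End k _) ^ e = 1
      rw [hh, dualMap_pow, one_pow]; rfl
  | succ d ih =>
    exact InT.retr ((retr_du (Retr_Pd d hd (by omega) h1) e).trans (retr_du_tens _ _ e))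
      ((ih (by omega)).mul hP1)

lemma retr_T (h1 : 1 < p) (hM : Retr (mon k (Td p 1 h1)) M) (hP1 : InT M (mon k (Td p 1 h1)))
    (d : ℕ) (hd : d + 1 < p) : ∃ n, Retr (mon k (Td p (d+1) hd)) (TP M n) := by
  induction d with
  | zero => exact ⟨0, hM⟩
  | succ d ih =>
    obtain ⟨n, hn⟩ := ih (by omega)
    obtain ⟨n', hn'⟩ := hP1 n
    exact ⟨n', (Retr_Pd (d+1) hd (by omega) h1).trans ((hn.tens (Retr.refl _)).trans hn')⟩

/-- iterated tensoring with K -/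
noncomputable def sh (k : Type) [Field k] [CharP k p] : ℕ → RMod k p → RMod k p
  | 0, N => N
  | m + 1, N => tens (sh k m N) (mon k (Kq p))

lemma SR.sh (h : SR X Y) (m : ℕ) : SR (sh k m X) (sh k m Y) := by
  induction m with
  | zero => exact h
  | succ m ih => exact SR.tens_right (Fact.out : p.Prime).pos ih _

lemma sh_succ (m : ℕ) (N : RMod k p) : SpNA.sh k m (tens N (mon k (Kq p))) = SpNA.sh k (m+1) N := by
  induction m with
  | zero => rfl
  | succ m ih => exact congrArg (fun x => tens x (mon k (Kq p))) ih

lemma ses_N (N : RMod k p) : ∃ j π, SES (tens N (mon k (Kq p))) (tens N (mon k (Sq p))) N j π := by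
  obtain ⟨j, π, h⟩ := ses_K (k := k) (p := p)
  have := (ses_tens_left h N).congr (Q' := N) (TensorProduct.rid k N.V) (by
    constructor <;> refine TensorProduct.ext' fun a b => ?_
    · change (TensorProduct.rid k N.V) (N.g a ⊗ₜ b) = N.g ((TensorProduct.rid k N.V) (a ⊗ₜ b))
      simp
    · change (TensorProduct.rid k N.V) (N.h a ⊗ₜ b) = N.h ((TensorProduct.rid k N.V) (a ⊗ₜ b))
      simp)
  exact ⟨_, _, this⟩

lemma Bd_sh (N : RMod k p) [FiniteDimensional k N.V] (m : ℕ) :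
    Bd m (SpNA.sh k m N) (Module.finrank k N.V) := by
  induction m with
  | zero => exact Bd_zero N
  | succ m ih =>
    obtain ⟨j, π, h⟩ := ses_N (SpNA.sh k m N)
    exact Bd_shift h (Proj.acyclic (Proj_F.tens_left (Fact.out : p.Prime).pos _) m) ih

lemma SR_D (h1 : p - 1 < p) (h2 : p - 2 < p) (W : RMod k p) :
    SR (tens (mon k (Td p (p-1) h1)) W)
      (tens (tens (dual' (mon k (Td p (p-2) h2))) W) (mon k (Kq p))) := by
  obtain ⟨j, π, h⟩ := ses_R (k := k) h1 h2
  obtain ⟨j', π', h'⟩ := ses_N (tens (dual' (mon k (Td p (p-2) h2))) W)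
  have hp := (Fact.out : p.Prime).pos
  exact schanuel hp (ses_tens_right h W) h' (Proj_F.tens_right hp _) (Proj_F.tens_left hp _)

lemma retr_dual (N : RMod k p) : Retr (dual' N) (du 1 N) :=
  ⟨LinearMap.id, LinearMap.id, ⟨rfl, rfl⟩, ⟨rfl, rfl⟩, rfl⟩

lemma SR_step (h1 : p - 1 < p) (h2 : p - 2 < p) (Z : RMod k p) :
    SR (tens (mon k (Td p (p-1) h1)) Z)
      (tens (tens (mon k (Td p (p-1) h1)) (tens (dual' (mon k (Td p (p-2) h2)))
        (tens (du (p-1) (mon k (Td p (p-1) h1))) Z))) (mon k (Kq p))) := by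
  have hp := (Fact.out : p.Prime).pos
  set D := mon k (Td p (p-1) h1)
  set R := dual' (mon k (Td p (p-2) h2))
  have a1 : Retr (tens D Z) (tens D (tens (tens (du (p-1) D) D) Z)) :=
    ((retr_coev hp D).tens (Retr.refl Z)).trans (((retr_comm _ _).tens (Retr.refl Z)).trans (retr_assoc _ _ _))
  have a2 : Retr (tens R (tens (tens (du (p-1) D) D) Z)) (tens D (tens R (tens (du (p-1) D) Z))) :=
    ((Retr.refl R).tens (((retr_comm _ _).tens (Retr.refl Z)).trans (retr_assoc _ _ _))).trans
      ((retr_assoc' _ _ _).trans (((retr_comm R D).tens (Retr.refl _)).trans (retr_assoc _ _ _)))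
  exact a1.sr.trans ((SR_D h1 h2 _).trans (a2.sr.tens_right hp _))

theorem SR_main (h1 : 1 < p) (hd : p - 1 < p) (M : RMod k p) (m1 : Retr (mon k (Td p 1 h1)) M)
    (m2 : Retr (du 1 (mon k (Td p 1 h1))) M) (m3 : Retr (du (p-1) (mon k (Td p 1 h1))) M) (m : ℕ) :
    ∃ n, SR (mon k (Td p (p-1) hd)) (SpNA.sh k m (TP M n)) := by
  have h2 : p - 2 < p := by omega
  have i1 : InT M (mon k (Td p 1 h1)) := InT.self.retr m1
  have i2 : InT M (dual' (mon k (Td p (p-2) h2))) :=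
    InT.retr (retr_dual _) (InT_du 1 h1 (InT.self.retr m2) _ _)
  have i3 : InT M (du (p-1) (mon k (Td p (p-1) hd))) := InT_du (p-1) h1 (InT.self.retr m3) _ _
  obtain ⟨n, hn⟩ : ∃ n, Retr (mon k (Td p (p-1) hd)) (TP M n) := by
    have := retr_T h1 m1 i1 (p-2) (by omega)
    have e : p - 2 + 1 = p - 1 := by omega
    simpa only [e] using this
  have key : ∃ Z, InT M Z ∧ SR (mon k (Td p (p-1) hd)) (SpNA.sh k m (tens (mon k (Td p (p-1) hd)) Z)) := by
    induction m with
    | zero =>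
      refine ⟨triv p k k, InT.unit (LinearEquiv.refl k k) rfl rfl, Retr.sr ?_⟩
      refine Retr.of_equiv_symm (X := tens (mon k (Td p (p-1) hd)) (triv p k k))
        (Y := mon k (Td p (p-1) hd)) (TensorProduct.rid k _) ⟨?_, ?_⟩ <;>
        refine TensorProduct.ext' fun a b => ?_
      · exact (map_smul (mon k (Td p (p-1) hd)).g b a).symm
      · exact (map_smul (mon k (Td p (p-1) hd)).h b a).symm
    | succ m ih =>
      obtain ⟨Z, hZ, h⟩ := ih
      refine ⟨_, i2.mul (i3.mul hZ), ?_⟩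
      rw [← sh_succ]
      exact h.trans ((SR_step hd h2 Z).sh m)
  obtain ⟨Z, hZ, h⟩ := key
  obtain ⟨n', hn'⟩ := hZ n
  exact ⟨n', h.trans (((hn.tens (Retr.refl Z)).trans hn').sr.sh m)⟩

end cls
end SpNA


namespace SpNA
open scoped TensorProduct

section fin
variable {k : Type} [Field k] {p : ℕ} [Fact p.Prime] [CharP k p]

def Fc (m C : ℕ) (X : RMod k p) : Set (X.V →ₗ[k] X.V) :=
  {f | ∃ N : RMod k p, ∃ _ : FiniteDimensional k N.V, Module.finrank k N.V ≤ C ∧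
    ∃ (i : X.V →ₗ[k] (sh k m N).V) (r : (sh k m N).V →ₗ[k] X.V),
      IsHom X (sh k m N) i ∧ IsHom (sh k m N) X r ∧ f = r ∘ₗ i}

lemma Fc_step {m C : ℕ} {X : RMod k p} {f : X.V →ₗ[k] X.V} (hf : f ∈ AddSubmonoid.closure (Fc m C X)) :
    (TensorProduct.map f LinearMap.id : (tens X (mon k (Kq p))).V →ₗ[k] (tens X (mon k (Kq p))).V) ∈
      AddSubmonoid.closure (Fc (m+1) C (tens X (mon k (Kq p)))) := by
  induction hf using AddSubmonoid.closure_induction with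
  | mem f hf =>
    obtain ⟨N, hN, hC, i, r, hi, hr, rfl⟩ := hf
    refine AddSubmonoid.subset_closure ⟨N, hN, hC, TensorProduct.map i LinearMap.id,
      TensorProduct.map r LinearMap.id, hi.tens IsHom.id, hr.tens IsHom.id, ?_⟩
    exact TensorProduct.ext' fun a b => rfl
  | zero =>
    rw [TensorProduct.map_zero_left]
    exact AddSubmonoid.zero_mem _
  | add f f' _ _ h h' =>
    rw [TensorProduct.map_add_left]
    exact AddSubmonoid.add_mem _ h h'

lemma Fc_sh {C : ℕ} {X : RMod k p} (h : LinearMap.id ∈ AddSubmonoid.closure (Fc 0 C X)) (m : ℕ) :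
    LinearMap.id ∈ AddSubmonoid.closure (Fc m C (sh k m X)) := by
  induction m with
  | zero => exact h
  | succ m ih =>
    have := Fc_step ih
    rw [TensorProduct.map_id] at this
    exact this

lemma Fc_conj {m C : ℕ} {X Y : RMod k p} {i : X.V →ₗ[k] Y.V} {r : Y.V →ₗ[k] X.V} (hi : IsHom X Y i)
    (hr : IsHom Y X r) {f : Y.V →ₗ[k] Y.V} (hf : f ∈ AddSubmonoid.closure (Fc m C Y)) :
    r ∘ₗ f ∘ₗ i ∈ AddSubmonoid.closure (Fc m C X) := by
  induction hf using AddSubmonoid.closure_induction with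
  | mem f hf =>
    obtain ⟨N, hN, hC, i', r', hi', hr', rfl⟩ := hf
    exact AddSubmonoid.subset_closure ⟨N, hN, hC, i' ∘ₗ i, r ∘ₗ r', hi'.comp hi, hr.comp hr', rfl⟩
  | zero =>
    rw [LinearMap.zero_comp, LinearMap.comp_zero]
    exact AddSubmonoid.zero_mem _
  | add f f' _ _ h h' =>
    rw [LinearMap.add_comp, LinearMap.comp_add]
    exact AddSubmonoid.add_mem _ h h'

lemma Bd_mono {m c c' : ℕ} {N : RMod k p} (h : Bd m N c) (hc : c ≤ c') : Bd m N c' := by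
  obtain ⟨W, a, b, d, L, hW, hL⟩ := h
  exact ⟨W, a, b, d, L, hW.trans hc, hL⟩

theorem RMod_final (h1 : 1 < p) (M : RMod k p) (m1 : Retr (mon k (Td p 1 h1)) M)
    (m2 : Retr (du 1 (mon k (Td p 1 h1))) M) (m3 : Retr (du (p-1) (mon k (Td p 1 h1))) M) (C : ℕ)
    (hC : ∀ n, LinearMap.id ∈ AddSubmonoid.closure (Fc 0 C (TP M n))) : False := by
  have hd : p - 1 < p := by omega
  refine D_unbounded (k := k) hd C fun m => ?_
  obtain ⟨n, i, r, θ, hi, hr, h⟩ := SR_main h1 hd M m1 m2 m3 m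
  have hmem := Fc_conj hi hr (Fc_sh (hC n) m)
  rw [LinearMap.id_comp] at hmem
  set D := mon k (Td p (p-1) hd) with hD
  by_cases hex : ∃ f ∈ Fc m C D, Function.Injective f
  · obtain ⟨f, ⟨N, hN, hNC, i', r', hi', hr', rfl⟩, hinj⟩ := hex
    have hbij : Function.Bijective (r' ∘ₗ i') := ⟨hinj, LinearMap.injective_iff_surjective.1 hinj⟩
    let e : D.V ≃ₗ[k] D.V := LinearEquiv.ofBijective _ hbij
    have he : ∀ v, e v = r' (i' v) := fun v => rfl
    have hc := hr'.comp hi'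
    have hes : IsHom D D e.symm.toLinearMap := by
      constructor
      · ext1 v
        have := LinearMap.congr_fun hc.1 (e.symm v)
        apply e.injective
        simp only [LinearMap.comp_apply, LinearEquiv.coe_coe] at this ⊢
        rw [LinearEquiv.apply_symm_apply, he, this, ← he, LinearEquiv.apply_symm_apply]
      · ext1 v
        have := LinearMap.congr_fun hc.2 (e.symm v)
        apply e.injective
        simp only [LinearMap.comp_apply, LinearEquiv.coe_coe] at this ⊢
        rw [LinearEquiv.apply_symm_apply, he, this, ← he, LinearEquiv.apply_symm_apply]
    refine Bd_retr hi' (hes.comp hr') ?_ (Bd_mono (Bd_sh N m) hNC)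
    ext1 v
    simp only [LinearMap.comp_apply, LinearEquiv.coe_coe, ← he, LinearEquiv.symm_apply_apply]
    rfl
  · exfalso
    push Not at hex
    have hz : ∀ f ∈ AddSubmonoid.closure (Fc m C D), f (Eb k (Td p (p-1) hd) 0 0) = 0 := by
      intro f hf
      induction hf using AddSubmonoid.closure_induction with
      | mem f hf =>
        have hni := hex f hf
        obtain ⟨N, hN, hNC, i', r', hi', hr', rfl⟩ := hf
        obtain ⟨χ, h1, h2⟩ := local_D hd _ (hr'.comp hi')
        rw [h1]
        by_cases h0 : χ = 0
        · rw [h0, zero_smul]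
        · exact absurd (h2 h0) hni
      | zero => rfl
      | add f f' _ _ h h' => rw [LinearMap.add_apply, h, h', add_zero]
    have h3 := LinearMap.congr_fun h (Eb k (Td p (p-1) hd) 0 0)
    rw [LinearMap.add_apply, Tr_D, hz _ hmem] at h3
    have h4 : (Eb k (Td p (p-1) hd) 0 0).1 0 0 = 1 := Eb_pos _ (by simp [Td])
    rw [LinearMap.id_apply] at h3
    rw [← h3] at h4
    simp at h4
end fin
end SpNA

open CategoryTheory CategoryTheory.MonoidalCategory
open AlgebraicModule
namespace SpNA
open scoped TensorProduct

section cat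
variable {k G : Type} [Field k] [Monoid G]

/-- underlying linear map -/
def lm {X Y : FDRep k G} (f : X ⟶ Y) : X.V →ₗ[k] Y.V := f.hom.hom.hom

lemma lm_comp {X Y Z : FDRep k G} (f : X ⟶ Y) (f' : Y ⟶ Z) : lm (f ≫ f') = lm f' ∘ₗ lm f := rfl
lemma lm_id (X : FDRep k G) : lm (𝟙 X) = LinearMap.id := rfl
lemma lm_add {X Y : FDRep k G} (f f' : X ⟶ Y) : lm (f + f') = lm f + lm f' := rfl
lemma lm_zero {X Y : FDRep k G} : lm (0 : X ⟶ Y) = 0 := rfl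
lemma lm_inj {X Y : FDRep k G} {f f' : X ⟶ Y} (h : lm f = lm f') : f = f' := by
  apply Action.Hom.ext
  apply InducedCategory.hom_ext
  exact ModuleCat.hom_ext h
lemma lm_comm {X Y : FDRep k G} (f : X ⟶ Y) (g : G) : lm f ∘ₗ X.ρ g = Y.ρ g ∘ₗ lm f := by
  have := f.comm g
  exact congrArg (fun z => z.hom.hom) this

lemma split_idem {X : FDRep k G} (e : X ⟶ X) (he : e ≫ e = e) :
    ∃ (Y : FDRep k G) (i : Y ⟶ X) (r : X ⟶ Y), i ≫ r = 𝟙 Y ∧ r ≫ i = e := by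
  have : IsIdempotentComplete (FDRep k G) :=
    Idempotents.isIdempotentComplete_iff_idempotents_have_kernels _ |>.2 fun X p _ => inferInstance
  exact IsIdempotentComplete.idempotents_split X e he

lemma dim_lt {X Y : FDRep k G} (i : Y ⟶ X) (r : X ⟶ Y) (h : i ≫ r = 𝟙 Y) (hne : r ≫ i ≠ 𝟙 X) :
    Module.finrank k Y.V < Module.finrank k X.V := by
  have h1 : ∀ v, lm r (lm i v) = v := fun v => by
    have := congrArg lm h
    rw [lm_comp, lm_id] at this
    exact LinearMap.congr_fun this v
  have hinj : Function.Injective (lm i) := Function.LeftInverse.injective h1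
  refine lt_of_le_of_ne (LinearMap.finrank_le_finrank_of_injective hinj) fun heq => hne ?_
  have hs : Function.Surjective (lm i) := (LinearMap.injective_iff_surjective_of_finrank_eq_finrank heq).1 hinj
  apply lm_inj
  rw [lm_comp, lm_id]
  ext v
  obtain ⟨w, rfl⟩ := hs v
  simp [h1]

def Fl (L : List (FDRep k G)) (X : FDRep k G) : Set (X ⟶ X) :=
  {f | ∃ N ∈ L, ∃ (i : X ⟶ N) (r : N ⟶ X), f = i ≫ r}

lemma Fl_conj {L : List (FDRep k G)} {X Y : FDRep k G} (i : X ⟶ Y) (r : Y ⟶ X) {f : Y ⟶ Y}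
    (hf : f ∈ AddSubmonoid.closure (Fl L Y)) : i ≫ f ≫ r ∈ AddSubmonoid.closure (Fl L X) := by
  induction hf using AddSubmonoid.closure_induction with
  | mem f hf =>
    obtain ⟨N, hN, i', r', rfl⟩ := hf
    exact AddSubmonoid.subset_closure ⟨N, hN, i ≫ i', r' ≫ r, by simp⟩
  | zero => simp
  | add f f' _ _ h h' =>
    rw [Preadditive.add_comp, Preadditive.comp_add]
    exact AddSubmonoid.add_mem _ h h'

lemma alg_dec {M : FDRep k G} {L : List (FDRep k G)} (hL : ∀ N : FDRep k G, AlgebraicModule.Indecomposable N →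
    (∃ n : ℕ, IsSummand N (tensorPow M n)) → ∃ N' ∈ L, Nonempty (N ≅ N')) (n : ℕ) (d : ℕ) :
    ∀ X : FDRep k G, Module.finrank k X.V ≤ d → IsSummand X (tensorPow M n) →
      𝟙 X ∈ AddSubmonoid.closure (Fl L X) := by
  induction d with
  | zero =>
    intro X hX _
    have : 𝟙 X = 0 := by
      apply lm_inj
      have := Module.finrank_zero_iff.1 (Nat.le_zero.1 hX)
      ext v
      exact Subsingleton.elim _ _
    rw [this]; exact AddSubmonoid.zero_mem _
  | succ d ih =>
    intro X hX hs
    by_cases hz : 𝟙 X = 0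
    · rw [hz]; exact AddSubmonoid.zero_mem _
    by_cases hi : AlgebraicModule.Indecomposable X
    · obtain ⟨N, hN, ⟨φ⟩⟩ := hL X hi ⟨n, hs⟩
      exact AddSubmonoid.subset_closure ⟨N, hN, φ.hom, φ.inv, by simp⟩
    · have hnz : ¬ Limits.IsZero X := fun h => hz (h.eq_of_src _ _)
      have : ∃ e : X ⟶ X, e ≫ e = e ∧ e ≠ 0 ∧ e ≠ 𝟙 X := by
        by_contra hcon
        push Not at hcon
        exact hi ⟨hnz, fun e he => or_iff_not_imp_left.2 (hcon e he)⟩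
      have key : ∀ e : X ⟶ X, e ≫ e = e → e ≠ 𝟙 X → e ∈ AddSubmonoid.closure (Fl L X) := by
        intro e he he1
        obtain ⟨Y, i, r, h1, h2⟩ := split_idem e he
        obtain ⟨a, b, hab⟩ := hs
        have := ih Y (by have := dim_lt i r h1 (by rwa [h2]); omega) ⟨i ≫ a, b ≫ r, by
          rw [Category.assoc, reassoc_of% hab, h1]⟩
        have := Fl_conj r i this
        rwa [Category.id_comp, h2] at this
      obtain ⟨e, he, h0, h1⟩ := this
      have h2 := key (𝟙 X - e) (by simp [he]) (by simpa using h0)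
      have := AddSubmonoid.add_mem _ (key e he h1) h2
      simpa using this

end cat

section res
variable {k G : Type} [Field k] [Monoid G] {p : ℕ} (a b : G) (ha : a ^ p = 1) (hb : b ^ p = 1)
  (hab : a * b = b * a)

@[reducible] noncomputable def res (X : FDRep k G) : RMod k p where
  V := X.V
  g := X.ρ a
  h := X.ρ b
  gp := by rw [← map_pow, ha, map_one]
  hp := by rw [← map_pow, hb, map_one]
  comm := by rw [← map_mul, hab, map_mul]

lemma res_tensor (M : FDRep k G) (n : ℕ) :
    res a b ha hb hab (tensorPow M n) = TP (res a b ha hb hab M) n := by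
  induction n with
  | zero => rfl
  | succ n ih =>
    change _ = tens (TP (res a b ha hb hab M) n) (res a b ha hb hab M)
    rw [← ih]
    rfl

theorem nonalg [Fact p.Prime] [CharP k p] (M : FDRep k G) (h1 : 1 < p)
    (m1 : Retr (mon k (Td p 1 h1)) (res a b ha hb hab M))
    (m2 : Retr (du 1 (mon k (Td p 1 h1))) (res a b ha hb hab M))
    (m3 : Retr (du (p-1) (mon k (Td p 1 h1))) (res a b ha hb hab M)) : ¬ AlgebraicModule.IsAlgebraic M := by
  rintro ⟨L, hL⟩
  refine RMod_final h1 _ m1 m2 m3 (L.map (fun N => Module.finrank k N.V)).sum fun n => ?_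
  rw [← res_tensor]
  have := alg_dec hL n _ (tensorPow M n) le_rfl ⟨𝟙 _, 𝟙 _, by simp⟩
  have key : ∀ f ∈ AddSubmonoid.closure (Fl L (tensorPow M n)), lm f ∈
      AddSubmonoid.closure (Fc 0 (L.map (fun N => Module.finrank k N.V)).sum (res a b ha hb hab (tensorPow M n))) := by
    intro f hf
    induction hf using AddSubmonoid.closure_induction with
    | mem f hf =>
      obtain ⟨N, hN, i, r, rfl⟩ := hf
      refine AddSubmonoid.subset_closure ⟨res a b ha hb hab N, inferInstanceAs (FiniteDimensional k N.V),
        ?_, lm i, lm r, ⟨lm_comm i a, lm_comm i b⟩, ⟨lm_comm r a, lm_comm r b⟩, rfl⟩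
      exact List.single_le_sum (by simp) _ (List.mem_map.2 ⟨N, hN, rfl⟩)
    | zero => exact AddSubmonoid.zero_mem _
    | add f f' _ _ h h' =>
      rw [lm_add]
      exact AddSubmonoid.add_mem _ h h'
  exact key _ this

end res
end SpNA

open CategoryTheory CategoryTheory.MonoidalCategory
open AlgebraicModule
namespace SpNA
open scoped TensorProduct

lemma one_add_pow {R : Type} [Ring R] (N : R) (h : N * N = 0) (m : ℕ) : (1 + N) ^ m = 1 + m • N := by
  induction m with
  | zero => simp
  | succ m ih =>
    rw [pow_succ, ih, add_smul, one_smul, mul_add, mul_one, add_mul, one_mul, smul_mul_assoc, h, smul_zero]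
    abel

section elts
variable {k : Type} [Field k] {n : ℕ}

def nil (i j : Fin n) : Matrix (Fin n ⊕ Fin n) (Fin n ⊕ Fin n) k :=
  Matrix.fromBlocks (Matrix.single i j 1) 0 0 (-Matrix.single j i 1)

lemma nil_mul (i j i' j' : Fin n) (h : j ≠ i') (h' : i ≠ j') : (nil i j * nil i' j' : Matrix _ _ k) = 0 := by
  simp [nil, Matrix.fromBlocks_multiply, Matrix.single_mul_single_of_ne, h, h']

lemma nil_J (i j : Fin n) : (nil i j * Matrix.J (Fin n) k) = - (Matrix.J (Fin n) k * (nil i j).transpose) := by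
  simp [nil, Matrix.J, Matrix.fromBlocks_multiply, Matrix.fromBlocks_transpose, Matrix.fromBlocks_neg]

lemma u_mem (i j : Fin n) (h : i ≠ j) : (1 + nil i j : Matrix _ _ k) ∈ Matrix.symplecticGroup (Fin n) k := by
  rw [SymplecticGroup.mem_iff, Matrix.transpose_add, Matrix.transpose_one]
  have h1 := nil_J (k := k) i j
  have h2 := nil_mul (k := k) i j i j h.symm h
  have h3 : nil i j * Matrix.J (Fin n) k * (nil i j).transpose = 0 := by
    rw [h1, neg_mul, mul_assoc, ← Matrix.transpose_mul, h2]; simp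
  rw [add_mul, one_mul, add_mul, mul_add, mul_add, h3, h1]
  simp

def u (i j : Fin n) (h : i ≠ j) : Matrix.symplecticGroup (Fin n) k := ⟨1 + nil i j, u_mem i j h⟩

lemma u_pow {p : ℕ} [CharP k p] (i j : Fin n) (h : i ≠ j) : (u i j h : Matrix.symplecticGroup (Fin n) k) ^ p = 1 := by
  apply Subtype.ext
  change (1 + nil i j : Matrix _ _ k) ^ p = 1
  rw [one_add_pow _ (nil_mul _ _ _ _ h.symm h), ← Nat.cast_smul_eq_nsmul k, CharP.cast_eq_zero, zero_smul, add_zero]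

lemma u_comm (i j j' : Fin n) (h : i ≠ j) (h' : i ≠ j') :
    (u i j h : Matrix.symplecticGroup (Fin n) k) * u i j' h' = u i j' h' * u i j h := by
  apply Subtype.ext
  change (1 + nil i j : Matrix _ _ k) * (1 + nil i j') = (1 + nil i j') * (1 + nil i j)
  rw [add_mul, add_mul, mul_add, mul_add, mul_add, mul_add, nil_mul _ _ _ _ h.symm h', nil_mul _ _ _ _ h'.symm h]
  simp
  abel

lemma u_inl (i j : Fin n) (h : i ≠ j) (w : Fin n ⊕ Fin n → k) (t : Fin n) :
    SpnatRep k n (u i j h) w (Sum.inl t) = w (Sum.inl t) + if t = i then w (Sum.inl j) else 0 := by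
  change ((1 + nil i j : Matrix _ _ k).mulVec w) (Sum.inl t) = _
  rw [Matrix.add_mulVec, Matrix.one_mulVec]
  simp [nil, Matrix.mulVec, dotProduct, Matrix.single_apply, ite_and, eq_comm]

lemma u_inr (i j : Fin n) (h : i ≠ j) (w : Fin n ⊕ Fin n → k) (t : Fin n) :
    SpnatRep k n (u i j h) w (Sum.inr t) = w (Sum.inr t) - if t = j then w (Sum.inr i) else 0 := by
  change ((1 + nil i j : Matrix _ _ k).mulVec w) (Sum.inr t) = _
  rw [Matrix.add_mulVec, Matrix.one_mulVec]
  simp [nil, Matrix.mulVec, dotProduct, Matrix.single_apply, ite_and, eq_comm, sub_eq_add_neg]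

def v3 (x y z : k) (t : Fin n) : k :=
  if t.1 = 0 then x else if t.1 = 1 then y else if t.1 = 2 then z else 0

lemma v3_1 (hn : 3 ≤ n) (x y z : k) :
    SpnatRep k n (u ⟨0, by omega⟩ ⟨1, by omega⟩ (by simp)) (Sum.elim (0 : Fin n → k) (v3 x y z))
      = Sum.elim (0 : Fin n → k) (v3 x (y - x) z) := by
  ext (t | t)
  · rw [u_inl]; simp
  · rw [u_inr]; simp only [v3, Sum.elim_inr, Fin.ext_iff]; split_ifs <;> simp_all
lemma v3_2 (hn : 3 ≤ n) (x y z : k) :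
    SpnatRep k n (u ⟨0, by omega⟩ ⟨2, by omega⟩ (by simp)) (Sum.elim (0 : Fin n → k) (v3 x y z))
      = Sum.elim (0 : Fin n → k) (v3 x y (z - x)) := by
  ext (t | t)
  · rw [u_inl]; simp
  · rw [u_inr]; simp only [v3, Sum.elim_inr, Fin.ext_iff]; split_ifs <;> simp_all

variable {p : ℕ} [Fact p.Prime] [CharP k p]

lemma P1_eq (h1 : 1 < p) (f : Fn k (Td p 1 h1).S) :
    f = f.1 0 0 • Eb k (Td p 1 h1) 0 0 + f.1 1 0 • Eb k (Td p 1 h1) 1 0 + f.1 0 1 • Eb k (Td p 1 h1) 0 1 := by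
  refine Subtype.ext (funext fun a => funext fun b => ?_)
  change f.1 a b = f.1 0 0 * (Eb k (Td p 1 h1) 0 0).1 a b + f.1 1 0 * (Eb k (Td p 1 h1) 1 0).1 a b
    + f.1 0 1 * (Eb k (Td p 1 h1) 0 1).1 a b
  by_cases hab : a + b ≤ 1
  · obtain ⟨rfl, rfl⟩ | ⟨rfl, rfl⟩ | ⟨rfl, rfl⟩ : (a = 0 ∧ b = 0) ∨ (a = 1 ∧ b = 0) ∨ (a = 0 ∧ b = 1) := by omega
    all_goals simp [Eb, Td]
  · rw [f.2 a b hab, (Eb k (Td p 1 h1) 0 0).2 a b hab, (Eb k (Td p 1 h1) 1 0).2 a b hab,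
      (Eb k (Td p 1 h1) 0 1).2 a b hab]
    simp

lemma P1_ext (h1 : 1 < p) {f f' : Fn k (Td p 1 h1).S} (e0 : f.1 0 0 = f'.1 0 0) (e1 : f.1 1 0 = f'.1 1 0)
    (e2 : f.1 0 1 = f'.1 0 1) : f = f' := by
  rw [P1_eq h1 f, P1_eq h1 f', e0, e1, e2]

noncomputable def mk3 (h1 : 1 < p) (x y z : k) : Fn k (Td p 1 h1).S :=
  x • Eb k (Td p 1 h1) 0 0 + y • Eb k (Td p 1 h1) 1 0 + z • Eb k (Td p 1 h1) 0 1

lemma mk3_00 (h1 : 1 < p) (x y z : k) : (mk3 h1 x y z).1 0 0 = x := by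
  change x * (Eb k (Td p 1 h1) 0 0).1 0 0 + y * (Eb k (Td p 1 h1) 1 0).1 0 0
    + z * (Eb k (Td p 1 h1) 0 1).1 0 0 = x
  simp [Eb, Td]
lemma mk3_10 (h1 : 1 < p) (x y z : k) : (mk3 h1 x y z).1 1 0 = y := by
  change x * (Eb k (Td p 1 h1) 0 0).1 1 0 + y * (Eb k (Td p 1 h1) 1 0).1 1 0
    + z * (Eb k (Td p 1 h1) 0 1).1 1 0 = y
  simp [Eb, Td]
lemma mk3_01 (h1 : 1 < p) (x y z : k) : (mk3 h1 x y z).1 0 1 = z := by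
  change x * (Eb k (Td p 1 h1) 0 0).1 0 1 + y * (Eb k (Td p 1 h1) 1 0).1 0 1
    + z * (Eb k (Td p 1 h1) 0 1).1 0 1 = z
  simp [Eb, Td]

noncomputable def resM (k : Type) [Field k] (p : ℕ) [CharP k p] {n : ℕ} (hn : 3 ≤ n) : RMod k p :=
  res (u ⟨0, by omega⟩ ⟨1, by omega⟩ (by simp)) (u ⟨0, by omega⟩ ⟨2, by omega⟩ (by simp))
    (u_pow _ _ _) (u_pow _ _ _) (u_comm _ _ _ _ _) (FDRep.of (SpnatRep k n))

lemma resM1 {n : ℕ} (hn : 3 ≤ n) (h1 : 1 < p) : Retr (mon k (Td p 1 h1)) (resM k p hn) := by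
  let i : (Fn k (Td p 1 h1).S) →ₗ[k] (Fin n ⊕ Fin n → k) :=
    { toFun := fun f => Sum.elim (v3 (f.1 0 0) (f.1 1 0) (f.1 0 1)) 0
      map_add' := fun f f' => by
        ext (t | t)
        · simp only [v3, Sum.elim_inl, Pi.add_apply, Submodule.coe_add]; split_ifs <;> simp
        · simp
      map_smul' := fun c f => by
        ext (t | t)
        · simp only [v3, Sum.elim_inl, Pi.smul_apply, Submodule.coe_smul]; split_ifs <;> simp
        · simp }
  let r : (Fin n ⊕ Fin n → k) →ₗ[k] (Fn k (Td p 1 h1).S) :=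
    { toFun := fun w => mk3 h1 (w (Sum.inl ⟨0, by omega⟩)) (w (Sum.inl ⟨1, by omega⟩)) (w (Sum.inl ⟨2, by omega⟩))
      map_add' := fun f f' => by simp only [mk3, Pi.add_apply, add_smul]; abel
      map_smul' := fun c f => by simp only [mk3, Pi.smul_apply, smul_eq_mul, mul_smul, smul_add, RingHom.id_apply] }
  have f11 : ∀ (f : Fn k (Td p 1 h1).S) a b, 1 < a + b → f.1 a b = 0 := fun f a b h => f.2 a b (by simp only [Td]; omega)
  have hr0 : ∀ w : Fin n ⊕ Fin n → k, (r w).1 0 0 = w (Sum.inl ⟨0, by omega⟩) := fun w => mk3_00 h1 _ _ _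
  have hr1 : ∀ w : Fin n ⊕ Fin n → k, (r w).1 1 0 = w (Sum.inl ⟨1, by omega⟩) := fun w => mk3_10 h1 _ _ _
  have hr2 : ∀ w : Fin n ⊕ Fin n → k, (r w).1 0 1 = w (Sum.inl ⟨2, by omega⟩) := fun w => mk3_01 h1 _ _ _
  have hg : ∀ w : Fin n ⊕ Fin n → k, r (SpnatRep k n (u ⟨0, by omega⟩ ⟨1, by omega⟩ (by simp)) w) = r w + mx k _ (r w) := by
    intro w
    refine P1_ext h1 ?_ ?_ ?_
    · change _ = (r w).1 0 0 + (r w).1 1 0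
      rw [hr0, hr0, hr1, u_inl]; simp
    · change _ = (r w).1 1 0 + (r w).1 2 0
      rw [hr1, hr1, f11 _ 2 0 (by omega), u_inl]; simp
    · change _ = (r w).1 0 1 + (r w).1 1 1
      rw [hr2, hr2, f11 _ 1 1 (by omega), u_inl]; simp
  have hh : ∀ w : Fin n ⊕ Fin n → k, r (SpnatRep k n (u ⟨0, by omega⟩ ⟨2, by omega⟩ (by simp)) w) = r w + my k _ (r w) := by
    intro w
    refine P1_ext h1 ?_ ?_ ?_
    · change _ = (r w).1 0 0 + (r w).1 0 1
      rw [hr0, hr0, hr2, u_inl]; simp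
    · change _ = (r w).1 1 0 + (r w).1 1 1
      rw [hr1, hr1, f11 _ 1 1 (by omega), u_inl]; simp
    · change _ = (r w).1 0 1 + (r w).1 0 2
      rw [hr2, hr2, f11 _ 0 2 (by omega), u_inl]; simp
  refine ⟨i, r, ⟨?_, ?_⟩, ⟨?_, ?_⟩, ?_⟩
  · refine LinearMap.ext fun f => ?_
    change Sum.elim (v3 (f.1 0 0 + f.1 1 0) (f.1 1 0 + f.1 2 0) (f.1 0 1 + f.1 1 1)) 0 =
      SpnatRep k n (u _ _ _) (Sum.elim (v3 (f.1 0 0) (f.1 1 0) (f.1 0 1)) 0)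
    rw [f11 f 2 0 (by omega), f11 f 1 1 (by omega)]
    ext (t | t)
    · rw [u_inl]; simp only [v3, Sum.elim_inl, Fin.ext_iff]; split_ifs <;> simp_all
    · rw [u_inr]; simp
  · refine LinearMap.ext fun f => ?_
    change Sum.elim (v3 (f.1 0 0 + f.1 0 1) (f.1 1 0 + f.1 1 1) (f.1 0 1 + f.1 0 2)) 0 =
      SpnatRep k n (u _ _ _) (Sum.elim (v3 (f.1 0 0) (f.1 1 0) (f.1 0 1)) 0)
    rw [f11 f 0 2 (by omega), f11 f 1 1 (by omega)]
    ext (t | t)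
    · rw [u_inl]; simp only [v3, Sum.elim_inl, Fin.ext_iff]; split_ifs <;> simp_all
    · rw [u_inr]; simp
  · exact LinearMap.ext hg
  · exact LinearMap.ext hh
  · refine LinearMap.ext fun f => ?_
    exact (P1_eq h1 f).symm

lemma resM2 {n : ℕ} (hn : 3 ≤ n) (h1 : 1 < p) (e : ℕ) (c : k) (hc : c * c = 1) (he : (e : k) = c) :
    Retr (du e (mon k (Td p 1 h1))) (resM k p hn) := by
  have f11 : ∀ (f : Fn k (Td p 1 h1).S) a b, 1 < a + b → f.1 a b = 0 := fun f a b h => f.2 a b (by simp only [Td]; omega)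
  have hx : ((mon k (Td p 1 h1)).g) ^ e = 1 + c • mx k (Td p 1 h1) := by
    rw [← he, Nat.cast_smul_eq_nsmul]
    refine one_add_pow _ ?_ e
    refine LinearMap.ext fun f => Subtype.ext (funext fun a => funext fun b => ?_)
    exact f11 f (a+1+1) b (by omega)
  have hy : ((mon k (Td p 1 h1)).h) ^ e = 1 + c • my k (Td p 1 h1) := by
    rw [← he, Nat.cast_smul_eq_nsmul]
    refine one_add_pow _ ?_ e
    refine LinearMap.ext fun f => Subtype.ext (funext fun a => funext fun b => ?_)
    exact f11 f a (b+1+1) (by omega)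
  let E0 := Eb k (Td p 1 h1) 0 0
  let E1 := Eb k (Td p 1 h1) 1 0
  let E2 := Eb k (Td p 1 h1) 0 1
  have x0 : mx k _ E0 = 0 := Subtype.ext (funext fun a => funext fun b => Eb_neg _ (by omega))
  have x1 : mx k _ E1 = E0 := mx_Eb _ 0 0 (by simp [Td])
  have x2 : mx k _ E2 = 0 := Subtype.ext (funext fun a => funext fun b => Eb_neg _ (by omega))
  have y0 : my k _ E0 = 0 := Subtype.ext (funext fun a => funext fun b => Eb_neg _ (by omega))
  have y2 : my k _ E2 = E0 := my_Eb _ 0 0 (by simp [Td])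
  have y1 : my k _ E1 = 0 := Subtype.ext (funext fun a => funext fun b => Eb_neg _ (by omega))
  have hgd : (du e (mon k (Td p 1 h1))).g = ((mon k (Td p 1 h1)).g ^ e).dualMap := dualMap_pow _ _
  have hhd : (du e (mon k (Td p 1 h1))).h = ((mon k (Td p 1 h1)).h ^ e).dualMap := dualMap_pow _ _
  let i : Module.Dual k (Fn k (Td p 1 h1).S) →ₗ[k] (Fin n ⊕ Fin n → k) :=
    { toFun := fun φ => Sum.elim 0 (v3 (-c * φ E0) (φ E1) (φ E2))
      map_add' := fun f f' => by
        ext (t | t)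
        · simp
        · simp only [v3, Sum.elim_inr, Pi.add_apply, LinearMap.add_apply, mul_add]; split_ifs <;> simp
      map_smul' := fun c f => by
        ext (t | t)
        · simp
        · simp only [v3, Sum.elim_inr, Pi.smul_apply, LinearMap.smul_apply]; split_ifs <;> simp [mul_left_comm] }
  let r : (Fin n ⊕ Fin n → k) →ₗ[k] Module.Dual k (Fn k (Td p 1 h1).S) :=
    { toFun := fun w =>
        { toFun := fun f => -c * w (Sum.inr ⟨0, by omega⟩) * f.1 0 0 + w (Sum.inr ⟨1, by omega⟩) * f.1 1 0
            + w (Sum.inr ⟨2, by omega⟩) * f.1 0 1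
          map_add' := fun f f' => by simp only [Submodule.coe_add, Pi.add_apply]; ring
          map_smul' := fun a f => by
            simp only [Submodule.coe_smul, Pi.smul_apply, smul_eq_mul, RingHom.id_apply]; ring }
      map_add' := fun w w' => by ext f; simp; ring
      map_smul' := fun a w => by ext f; simp; ring }
  have hr : ∀ w (f : Fn k (Td p 1 h1).S), r w f = -c * w (Sum.inr ⟨0, by omega⟩) * f.1 0 0 + w (Sum.inr ⟨1, by omega⟩) * f.1 1 0
            + w (Sum.inr ⟨2, by omega⟩) * f.1 0 1 := fun _ _ => rfl
  have kg : ∀ (w : Fin n ⊕ Fin n → k) (f : Fn k (Td p 1 h1).S),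
      r (SpnatRep k n (u ⟨0, by omega⟩ ⟨1, by omega⟩ (by simp)) w) f = r w (f + c • mx k _ f) := by
    intro w f
    rw [map_add, map_smul, hr, hr, hr, u_inr, u_inr, u_inr, mx_apply, mx_apply, mx_apply,
      f11 f (1+1) 0 (by omega), f11 f (0+1) 1 (by omega)]
    simp
    linear_combination (w (Sum.inr ⟨0, by omega⟩) * f.1 1 0) * hc
  have kh : ∀ (w : Fin n ⊕ Fin n → k) (f : Fn k (Td p 1 h1).S),
      r (SpnatRep k n (u ⟨0, by omega⟩ ⟨2, by omega⟩ (by simp)) w) f = r w (f + c • my k _ f) := by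
    intro w f
    rw [map_add, map_smul, hr, hr, hr, u_inr, u_inr, u_inr, my_apply, my_apply, my_apply,
      f11 f 0 (1+1) (by omega), f11 f 1 (0+1) (by omega)]
    simp
    linear_combination (w (Sum.inr ⟨0, by omega⟩) * f.1 0 1) * hc
  refine ⟨i, r, ⟨?_, ?_⟩, ⟨?_, ?_⟩, ?_⟩
  · rw [hgd, hx]
    refine LinearMap.ext fun φ => ?_
    change Sum.elim (0 : Fin n → k) (v3 (-c * φ (E0 + c • mx k _ E0)) (φ (E1 + c • mx k _ E1)) (φ (E2 + c • mx k _ E2))) =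
      SpnatRep k n (u _ _ _) (Sum.elim (0 : Fin n → k) (v3 (-c * φ E0) (φ E1) (φ E2)))
    rw [x0, x1, x2]
    rw [v3_1 hn, map_add, map_add, map_add, map_smul, map_smul, map_zero, smul_zero, add_zero, add_zero,
      smul_eq_mul, neg_mul, sub_neg_eq_add]
  · rw [hhd, hy]
    refine LinearMap.ext fun φ => ?_
    change Sum.elim (0 : Fin n → k) (v3 (-c * φ (E0 + c • my k _ E0)) (φ (E1 + c • my k _ E1)) (φ (E2 + c • my k _ E2))) =
      SpnatRep k n (u _ _ _) (Sum.elim (0 : Fin n → k) (v3 (-c * φ E0) (φ E1) (φ E2)))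
    rw [y0, y1, y2]
    rw [v3_2 hn, map_add, map_add, map_add, map_smul, map_smul, map_zero, smul_zero, add_zero, add_zero,
      smul_eq_mul, neg_mul, sub_neg_eq_add]
  · rw [hgd, hx]
    exact LinearMap.ext fun w => LinearMap.ext fun f => kg w f
  · rw [hhd, hy]
    exact LinearMap.ext fun w => LinearMap.ext fun f => kh w f
  · refine LinearMap.ext fun φ => LinearMap.ext fun f => ?_
    change -c * (-c * φ E0) * f.1 0 0 + φ E1 * f.1 1 0 + φ E2 * f.1 0 1 = φ f
    have : φ f = f.1 0 0 * φ E0 + f.1 1 0 * φ E1 + f.1 0 1 * φ E2 := by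
      conv_lhs => rw [P1_eq h1 f]
      rw [map_add, map_add, map_smul, map_smul, map_smul]; rfl
    rw [this]
    linear_combination (φ E0 * f.1 0 0) * hc

end elts
end SpNA

theorem natural_module_Sp2n_nonalgebraic (p s : ℕ) [Fact p.Prime] (hs : s ≠ 0)
    (n : ℕ) (hn : 3 ≤ n) :
    ¬ IsAlgebraic (FDRep.of (SpnatRep (GaloisField p s) n)) := by
  have h1 : 1 < p := (Fact.out : p.Prime).one_lt
  exact SpNA.nonalg (SpNA.u ⟨0, by omega⟩ ⟨1, by omega⟩ (by simp)) (SpNA.u ⟨0, by omega⟩ ⟨2, by omega⟩ (by simp))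
    (SpNA.u_pow _ _ _) (SpNA.u_pow _ _ _) (SpNA.u_comm _ _ _ _ _) (FDRep.of (SpnatRep (GaloisField p s) n)) h1
    (SpNA.resM1 (k := GaloisField p s) hn h1)
    (SpNA.resM2 (k := GaloisField p s) hn h1 1 1 (by simp) (by simp))
    (SpNA.resM2 (k := GaloisField p s) hn h1 (p-1) (-1) (by simp) (by
      rw [Nat.cast_sub h1.le, CharP.cast_eq_zero]; simp))
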